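/- For all A, B ⊆ ℕ the following are equivalent: (i) A ≤_T B′ and A ≤_LR B; (ii) every Π^A_1 class in Cantor space has a Σ^B_2 subclass of the same μ-measure; (iii) every Σ^A_2 class in Cantor space has a Σ^B_2 subclass of the same μ-measure. -/

import Mathlib

open MeasureTheory Filter

namespace LMD

/-- Codes for partial functions recursive in an oracle. -/
inductive OracleCode : Type
  | zero : OracleCode
  | succ : OracleCode
  | left : OracleCode
  | right : OracleCode
  | oracle : OracleCode
  | pair : OracleCode → OracleCode → OracleCode
  | comp : OracleCode → OracleCode → OracleCode
  | prec : OracleCode → OracleCode → OracleCode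
  | rfind' : OracleCode → OracleCode

namespace OracleCode

/-- Evaluation of an oracle code relative to a (total) oracle `O : ℕ → ℕ`. -/
def eval (O : ℕ → ℕ) : OracleCode → ℕ →. ℕ
  | zero => pure 0
  | succ => Nat.succ
  | left => ↑fun n : ℕ => n.unpair.1
  | right => ↑fun n : ℕ => n.unpair.2
  | oracle => ↑fun n : ℕ => O n
  | pair cf cg => fun n => Nat.pair <$> eval O cf n <*> eval O cg n
  | comp cf cg => fun n => eval O cg n >>= eval O cf
  | prec cf cg =>
    Nat.unpaired fun a n =>
      n.rec (eval O cf a) fun y IH => do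
        let i ← IH
        eval O cg (Nat.pair a (Nat.pair y i))
  | rfind' cf =>
    Nat.unpaired fun a m =>
      (Nat.rfind fun n => (fun m => m = 0) <$> eval O cf (Nat.pair a (n + m))).map (· + m)

/-- A Gödel numbering of oracle codes. -/
def encodeCode : OracleCode → ℕ
  | zero => 0
  | succ => 1
  | left => 2
  | right => 3
  | oracle => 4
  | pair cf cg => 4 * Nat.pair (encodeCode cf) (encodeCode cg) + 5
  | comp cf cg => 4 * Nat.pair (encodeCode cf) (encodeCode cg) + 6
  | prec cf cg => 4 * Nat.pair (encodeCode cf) (encodeCode cg) + 7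
  | rfind' cf => 4 * encodeCode cf + 8

end OracleCode

/-- `f` is partial recursive in the oracle `O`. -/
def RecursiveIn (O : ℕ → ℕ) (f : ℕ →. ℕ) : Prop := ∃ c : OracleCode, c.eval O = f

/-- The characteristic function of a set of naturals. -/
noncomputable def chi (A : Set ℕ) : ℕ → ℕ := A.indicator fun _ => 1

/-- Turing reducibility between sets of naturals. -/
def TuringLE (A B : Set ℕ) : Prop := RecursiveIn (chi B) (chi A)

/-- The Turing jump of a set of naturals. -/
def jump (B : Set ℕ) : Set ℕ :=
  {e | ∃ c : OracleCode, c.encodeCode = e ∧ (c.eval (chi B) e).Dom}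

/-- The open subset of Cantor space generated by a set of finite binary strings. -/
def Cyl (W : Set (List Bool)) : Set (ℕ → Bool) :=
  {X | ∃ σ ∈ W, ∀ i : Fin σ.length, X i = σ.get i}

/-- The fair-coin product measure on Cantor space, realized as the pushforward of
Lebesgue measure on `[0,1)` under the binary expansion map. -/
noncomputable def mu : Measure (ℕ → Bool) :=
  Measure.map (fun x n => decide (⌊x * 2 ^ (n + 1)⌋₊ % 2 = 1))
    (volume.restrict (Set.Ico (0 : ℝ) 1))

/-- `W` is a c.e.-in-`A` set of binary strings. -/
def CeIn (A : Set ℕ) (W : Set (List Bool)) : Prop :=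
  ∃ c : OracleCode, ∀ σ : List Bool, σ ∈ W ↔ (c.eval (chi A) (Encodable.encode σ)).Dom

/-- `W` is a uniformly c.e.-in-`A` sequence of sets of binary strings. -/
def CeSeqIn (A : Set ℕ) (W : ℕ → Set (List Bool)) : Prop :=
  ∃ c : OracleCode, ∀ (n : ℕ) (σ : List Bool),
    σ ∈ W n ↔ (c.eval (chi A) (Nat.pair n (Encodable.encode σ))).Dom

/-- A Martin-Löf test relative to `A`. -/
def MLTest (A : Set ℕ) (U : ℕ → Set (ℕ → Bool)) : Prop :=
  ∃ W : ℕ → Set (List Bool), CeSeqIn A W ∧ (∀ n, U n = Cyl (W n)) ∧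
    (∀ n, U (n + 1) ⊆ U n) ∧ ∀ n, mu (U n) ≤ 2⁻¹ ^ n

/-- `X` is Martin-Löf random relative to `A`. -/
def MLRandom (A : Set ℕ) (X : ℕ → Bool) : Prop :=
  ∀ U : ℕ → Set (ℕ → Bool), MLTest A U → X ∉ ⋂ n, U n

/-- `A ≤_LR B`: every `B`-random is `A`-random. -/
def LRle (A B : Set ℕ) : Prop := ∀ X : ℕ → Bool, MLRandom B X → MLRandom A X

/-- Evaluation of an oracle machine on binary strings. -/
def evalStr (c : OracleCode) (O : ℕ → ℕ) (σ : List Bool) : Part (List Bool) :=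
  (c.eval O (Encodable.encode σ)).bind fun m => Part.ofOption (Encodable.decode m)

/-- `c` is a prefix-free oracle machine: for every oracle its domain is prefix-free. -/
def PrefixFreeMachine (c : OracleCode) : Prop :=
  ∀ (O : ℕ → ℕ) (σ₁ σ₂ : List Bool), σ₁ <+: σ₂ →
    (evalStr c O σ₁).Dom → (evalStr c O σ₂).Dom → σ₁ = σ₂

/-- `u` is a universal prefix-free oracle machine. -/
def UniversalPFM (u : OracleCode) : Prop :=
  PrefixFreeMachine u ∧
    ∀ c : OracleCode, PrefixFreeMachine c → ∃ d : ℕ, ∀ (O : ℕ → ℕ) (σ τ : List Bool),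
      τ ∈ evalStr c O σ → ∃ σ' : List Bool, τ ∈ evalStr u O σ' ∧ σ'.length ≤ σ.length + d

/-- Prefix-free Kolmogorov complexity relative to the oracle `O`,
measured by the universal machine `u` (`⊤` if `τ` is not in the range). -/
noncomputable def K (u : OracleCode) (O : ℕ → ℕ) (τ : List Bool) : ℕ∞ :=
  ⨅ σ ∈ {σ : List Bool | τ ∈ evalStr u O σ}, (σ.length : ℕ∞)

/-- `A ≤_LK B` with respect to the universal machine `u`. -/
def LKle (u : OracleCode) (A B : Set ℕ) : Prop :=
  ∃ d : ℕ, ∀ τ : List Bool, K u (chi B) τ ≤ K u (chi A) τ + (d : ℕ∞)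


/-- A `Σ^A_1` class in Cantor space. -/
def Sigma1In (A : Set ℕ) (S : Set (ℕ → Bool)) : Prop :=
  ∃ W : Set (List Bool), CeIn A W ∧ S = Cyl W

/-- A `Π^A_1` class in Cantor space. -/
def Pi1In (A : Set ℕ) (S : Set (ℕ → Bool)) : Prop :=
  ∃ W : Set (List Bool), CeIn A W ∧ S = (Cyl W)ᶜ

/-- A `Σ^A_2` class: a union of a uniformly `Π^A_1` sequence of classes. -/
def Sigma2In (A : Set ℕ) (S : Set (ℕ → Bool)) : Prop :=
  ∃ W : ℕ → Set (List Bool), CeSeqIn A W ∧ S = ⋃ n, (Cyl (W n))ᶜ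

/-- A `Π^A_2` class: an intersection of a uniformly `Σ^A_1` sequence of classes. -/
def Pi2In (A : Set ℕ) (S : Set (ℕ → Bool)) : Prop :=
  ∃ W : ℕ → Set (List Bool), CeSeqIn A W ∧ S = ⋂ n, Cyl (W n)

section Primitive

variable {α β γ : Type*} [Primcodable α] [Primcodable β] [Primcodable γ]

attribute [fun_prop] Primrec PrimrecPred
attribute [fun_prop] Primrec.id Primrec.const Primrec.comp Primrec.fst Primrec.snd Primrec.pair
  Primrec.list_length Primrec.list_range Primrec.unpair Primrec.encode Primrec.decode
  PrimrecPred.and PrimrecPred.or PrimrecPred.not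

@[fun_prop]
theorem primrec_id' : Primrec (fun x : α => x) := Primrec.id

@[fun_prop]
theorem primrec_add {f g : α → ℕ} (hf : Primrec f) (hg : Primrec g) :
    Primrec fun a => f a + g a := Primrec.nat_add.comp hf hg

@[fun_prop]
theorem primrec_mul {f g : α → ℕ} (hf : Primrec f) (hg : Primrec g) :
    Primrec fun a => f a * g a := Primrec.nat_mul.comp hf hg

@[fun_prop]
theorem primrec_pow {f g : α → ℕ} (hf : Primrec f) (hg : Primrec g) :
    Primrec fun a => f a ^ g a :=
  (Primrec₂.unpaired'.1 Nat.Primrec.pow).comp hf hg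

@[fun_prop]
theorem primrec_natPair {f g : α → ℕ} (hf : Primrec f) (hg : Primrec g) :
    Primrec fun a => Nat.pair (f a) (g a) := Primrec₂.natPair.comp hf hg

@[fun_prop]
theorem primrec_some {f : α → β} (hf : Primrec f) : Primrec fun a => some (f a) :=
  Primrec.option_some.comp hf

@[fun_prop]
theorem primrec_append {f g : α → List β} (hf : Primrec f) (hg : Primrec g) :
    Primrec fun a => f a ++ g a := Primrec.list_append.comp hf hg

@[fun_prop]
theorem primrec_cons {f : α → β} {g : α → List β} (hf : Primrec f) (hg : Primrec g) :
    Primrec fun a => f a :: g a := Primrec.list_cons.comp hf hg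

@[fun_prop]
theorem primrec_getElem? {f : α → List β} {g : α → ℕ} (hf : Primrec f) (hg : Primrec g) :
    Primrec fun a => (f a)[g a]? := Primrec.list_getElem?.comp hf hg

@[fun_prop]
theorem primrec_take {f : α → List β} {g : α → ℕ} (hf : Primrec f) (hg : Primrec g) :
    Primrec fun a => (f a).take (g a) := Primrec.list_take.comp hg hf

@[fun_prop]
theorem primrec_drop {f : α → List β} {g : α → ℕ} (hf : Primrec f) (hg : Primrec g) :
    Primrec fun a => (f a).drop (g a) := Primrec.list_drop.comp hg hf

@[fun_prop]
theorem primrec_flatten {f : α → List (List β)} (hf : Primrec f) :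
    Primrec fun a => (f a).flatten := Primrec.list_flatten.comp hf

@[fun_prop]
theorem primrec_map {f : α → List β} {g : α → β → γ} (hf : Primrec f)
    (hg : Primrec fun x : α × β => g x.1 x.2) : Primrec fun a => (f a).map (g a) :=
  Primrec.list_map hf hg

@[fun_prop]
theorem primrec_flatMap {f : α → List β} {g : α → β → List γ} (hf : Primrec f)
    (hg : Primrec fun x : α × β => g x.1 x.2) : Primrec fun a => (f a).flatMap (g a) :=
  Primrec.list_flatMap hf hg

@[fun_prop]
theorem primrecPred_comp {p : β → Prop} {f : α → β} (hp : PrimrecPred p) (hf : Primrec f) :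
    PrimrecPred fun a => p (f a) := hp.comp hf

@[fun_prop]
theorem primrecPred_const {p : Prop} : PrimrecPred fun _ : α => p :=
  ⟨fun _ => Classical.dec _, Primrec.const _⟩

@[fun_prop]
theorem primrecPred_eq {f g : α → β} (hf : Primrec f) (hg : Primrec g) :
    PrimrecPred fun a => f a = g a := Primrec.eq.comp hf hg

@[fun_prop]
theorem primrecPred_lt {f g : α → ℕ} (hf : Primrec f) (hg : Primrec g) :
    PrimrecPred fun a => f a < g a := Primrec.nat_lt.comp hf hg

@[fun_prop]
theorem primrecPred_le {f g : α → ℕ} (hf : Primrec f) (hg : Primrec g) :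
    PrimrecPred fun a => f a ≤ g a := Primrec.nat_le.comp hf hg

@[fun_prop]
theorem primrecPred_exists_mem {p : α → β → Prop} {l : α → List β}
    (hp : PrimrecPred fun x : α × β => p x.1 x.2) (hl : Primrec l) :
    PrimrecPred fun a => ∃ b, b ∈ l a ∧ p a b := by
  have hR : PrimrecRel fun (b : β) (a : α) => p a b :=
    (hp.comp (Primrec.pair Primrec.snd Primrec.fst) : PrimrecPred fun x : β × α => p x.2 x.1)
  exact hR.exists_mem_list.comp hl Primrec.id

@[fun_prop]
theorem primrecPred_forall_mem {p : α → β → Prop} {l : α → List β}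
    (hp : PrimrecPred fun x : α × β => p x.1 x.2) (hl : Primrec l) :
    PrimrecPred fun a => ∀ b, b ∈ l a → p a b := by
  have hR : PrimrecRel fun (b : β) (a : α) => p a b :=
    (hp.comp (Primrec.pair Primrec.snd Primrec.fst) : PrimrecPred fun x : β × α => p x.2 x.1)
  exact hR.forall_mem_list.comp hl Primrec.id

@[fun_prop]
theorem primrecPred_exists_lt {p : α → ℕ → Prop} {f : α → ℕ}
    (hp : PrimrecPred fun x : α × ℕ => p x.1 x.2) (hf : Primrec f) :
    PrimrecPred fun a => ∃ i, i < f a ∧ p a i := by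
  simpa using primrecPred_exists_mem hp (Primrec.list_range.comp hf)

@[fun_prop]
theorem primrecPred_forall_lt {p : α → ℕ → Prop} {f : α → ℕ}
    (hp : PrimrecPred fun x : α × ℕ => p x.1 x.2) (hf : Primrec f) :
    PrimrecPred fun a => ∀ i, i < f a → p a i := by
  simpa using primrecPred_forall_mem hp (Primrec.list_range.comp hf)

end Primitive

section SigmaOne

/-- The initial segment of length `s` of a sequence. -/
def initSeg {α : Type*} (X : ℕ → α) (s : ℕ) : List α := (List.range s).map X

section initSeg

variable {α : Type*} (X : ℕ → α)

@[simp]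
theorem length_initSeg (s : ℕ) : (initSeg X s).length = s := by simp [initSeg]

theorem getElem?_initSeg {s i : ℕ} (h : i < s) : (initSeg X s)[i]? = some (X i) := by
  simp [initSeg, h]

theorem getElem?_initSeg_eq_some {s i : ℕ} {a : α} :
    (initSeg X s)[i]? = some a ↔ i < s ∧ X i = a := by
  rcases lt_or_ge i s with h | h
  · rw [getElem?_initSeg X h]
    simp [h]
  · simp [initSeg, h]

theorem take_initSeg {s i : ℕ} (h : i ≤ s) : (initSeg X s).take i = initSeg X i := by
  simp [initSeg, ← List.map_take, List.take_range, h]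

theorem initSeg_succ (s : ℕ) : initSeg X (s + 1) = initSeg X s ++ [X s] := by
  simp [initSeg, List.range_succ]

theorem eq_initSeg_iff {l : List α} :
    l = initSeg X l.length ↔ ∀ i < l.length, l[i]? = some (X i) := by
  constructor
  · intro h i hi
    rw [h, getElem?_initSeg X hi]
  · intro h
    apply List.ext_getElem? fun i => ?_
    rcases lt_or_ge i l.length with hi | hi
    · rw [h i hi, getElem?_initSeg X hi]
    · simp [initSeg, hi]

theorem initSeg_add (m n : ℕ) :
    initSeg X (m + n) = initSeg X m ++ initSeg (fun i => X (m + i)) n := by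
  induction n with
  | zero => simp [initSeg]
  | succ n ih => rw [← add_assoc, initSeg_succ, ih, initSeg_succ, List.append_assoc]

end initSeg

variable {α β γ : Type*} [Primcodable α] [Primcodable β] [Primcodable γ] {A : Set ℕ}

/-- A predicate that is `Σ₁` relative to the oracle `A`, in normal form. -/
@[fun_prop]
def SigmaOne (A : Set ℕ) (p : α → Prop) : Prop :=
  ∃ r : α → List ℕ → Prop, PrimrecPred (fun x : α × List ℕ => r x.1 x.2) ∧
    ∀ a, p a ↔ ∃ s, r a (initSeg (chi A) s)

theorem SigmaOne.exists_mono {p : α → Prop} (hp : SigmaOne A p) :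
    ∃ r : α → List ℕ → Prop, PrimrecPred (fun x : α × List ℕ => r x.1 x.2) ∧
      (∀ a s t, s ≤ t → r a (initSeg (chi A) s) → r a (initSeg (chi A) t)) ∧
      ∀ a, p a ↔ ∃ s, r a (initSeg (chi A) s) := by
  obtain ⟨r, hr, h⟩ := hp
  refine ⟨fun a τ => ∃ i, i < τ.length + 1 ∧ r a (τ.take i), by fun_prop, ?_, ?_⟩
  · rintro a s t hst ⟨i, hi, hr⟩
    simp only [length_initSeg] at hi
    refine ⟨i, by simp; omega, ?_⟩
    rw [take_initSeg (chi A) (by omega)] at hr ⊢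
    exact hr
  · intro a
    rw [h]
    constructor
    · rintro ⟨s, hs⟩
      exact ⟨s, s, by simp, by rwa [take_initSeg (chi A) le_rfl]⟩
    · rintro ⟨s, i, hi, hr⟩
      simp only [length_initSeg] at hi
      rw [take_initSeg (chi A) (by omega)] at hr
      exact ⟨i, hr⟩

theorem SigmaOne.of_iff {p q : α → Prop} (hp : SigmaOne A p) (h : ∀ a, q a ↔ p a) :
    SigmaOne A q := by
  obtain rfl : q = p := funext fun a => propext (h a)
  exact hp

@[fun_prop]
theorem PrimrecPred.sigmaOne {p : α → Prop} (hp : PrimrecPred p) : SigmaOne A p :=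
  ⟨fun a _ => p a, by fun_prop, fun a => by simp⟩

@[fun_prop]
theorem SigmaOne.comp {p : β → Prop} {f : α → β} (hp : SigmaOne A p) (hf : Primrec f) :
    SigmaOne A fun a => p (f a) := by
  obtain ⟨r, hr, h⟩ := hp
  exact ⟨fun a τ => r (f a) τ, by fun_prop, fun a => h (f a)⟩

@[fun_prop]
theorem SigmaOne.and {p q : α → Prop} (hp : SigmaOne A p) (hq : SigmaOne A q) :
    SigmaOne A fun a => p a ∧ q a := by
  obtain ⟨r, hr, hrm, h⟩ := hp.exists_mono
  obtain ⟨r', hr', hrm', h'⟩ := hq.exists_mono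
  refine ⟨fun a τ => r a τ ∧ r' a τ, by fun_prop, fun a => ?_⟩
  show _ ∧ _ ↔ _
  rw [h, h']
  constructor
  · rintro ⟨⟨s, hs⟩, t, ht⟩
    exact ⟨max s t, hrm _ _ _ (le_max_left _ _) hs, hrm' _ _ _ (le_max_right _ _) ht⟩
  · rintro ⟨s, h1, h2⟩
    exact ⟨⟨s, h1⟩, s, h2⟩

@[fun_prop]
theorem SigmaOne.or {p q : α → Prop} (hp : SigmaOne A p) (hq : SigmaOne A q) :
    SigmaOne A fun a => p a ∨ q a := by
  obtain ⟨r, hr, h⟩ := hp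
  obtain ⟨r', hr', h'⟩ := hq
  refine ⟨fun a τ => r a τ ∨ r' a τ, by fun_prop, fun a => ?_⟩
  show _ ∨ _ ↔ ∃ s, _ ∨ _
  rw [h, h', exists_or]

theorem SigmaOne.exists {p : α → β → Prop} (hp : SigmaOne A fun x : α × β => p x.1 x.2) :
    SigmaOne A fun a => ∃ b, p a b := by
  obtain ⟨r, hr, hrm, h⟩ := hp.exists_mono
  refine ⟨fun a τ => ∃ k, k < τ.length ∧ ∃ b, b ∈ (Encodable.decode (α := β) k).toList ∧
    r (a, b) τ, ?_, fun a => ?_⟩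
  · refine primrecPred_exists_lt (primrecPred_exists_mem (by fun_prop) ?_) (by fun_prop)
    exact Primrec.optionToList.comp (by fun_prop)
  · constructor
    · rintro ⟨b, hb⟩
      obtain ⟨s, hs⟩ := (h (a, b)).1 hb
      exact ⟨max s (Encodable.encode b + 1), Encodable.encode b, by simp, b, by simp,
        hrm _ _ _ (le_max_left _ _) hs⟩
    · rintro ⟨s, k, -, b, -, hb⟩
      exact ⟨b, (h (a, b)).2 ⟨s, hb⟩⟩

theorem SigmaOne.forall_mem {p : α → β → Prop} {l : α → List β}
    (hp : SigmaOne A fun x : α × β => p x.1 x.2) (hl : Primrec l) :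
    SigmaOne A fun a => ∀ b, b ∈ l a → p a b := by
  obtain ⟨r, hr, hrm, h⟩ := hp.exists_mono
  refine ⟨fun a τ => ∀ b, b ∈ l a → r (a, b) τ, by fun_prop, fun a => ?_⟩
  show (∀ b ∈ l a, p a b) ↔ ∃ s, ∀ b ∈ l a, r (a, b) (initSeg (chi A) s)
  generalize l a = L
  constructor
  · intro hL
    induction L with
    | nil => exact ⟨0, by simp⟩
    | cons b L ih =>
      obtain ⟨s, hs⟩ := ih fun c hc => hL c (by simp [hc])
      obtain ⟨t, ht⟩ := (h (a, b)).1 (hL b (by simp))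
      refine ⟨max s t, fun c hc => ?_⟩
      rcases List.mem_cons.1 hc with rfl | hc
      · exact hrm _ _ _ (le_max_right _ _) ht
      · exact hrm _ _ _ (le_max_left _ _) (hs c hc)
  · rintro ⟨s, hs⟩ b hb
    exact (h (a, b)).2 ⟨s, hs b hb⟩

theorem SigmaOne.forall_lt {p : α → ℕ → Prop} {f : α → ℕ}
    (hp : SigmaOne A fun x : α × ℕ => p x.1 x.2) (hf : Primrec f) :
    SigmaOne A fun a => ∀ i, i < f a → p a i := by
  simpa using SigmaOne.forall_mem hp (Primrec.list_range.comp hf)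

theorem SigmaOne.initSeg_eq {f : α → List ℕ} {g : α → ℕ} (hf : Primrec f) (hg : Primrec g) :
    SigmaOne A fun a => f a = initSeg (chi A) (g a) := by
  refine ⟨fun a τ => τ.length = g a ∧ f a = τ, by fun_prop, fun a => ?_⟩
  constructor
  · intro h
    exact ⟨g a, by simp, h⟩
  · rintro ⟨s, h1, h2⟩
    simp only [length_initSeg] at h1
    rw [← h1, h2]

theorem SigmaOne.oracle_eq {f g : α → ℕ} (hf : Primrec f) (hg : Primrec g) :
    SigmaOne A fun a => chi A (f a) = g a := by
  refine ⟨fun a τ => τ[f a]? = some (g a), by fun_prop, fun a => ?_⟩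
  simp only [getElem?_initSeg_eq_some]
  exact ⟨fun h => ⟨f a + 1, by simp, h⟩, fun ⟨_, _, h⟩ => h⟩

attribute [fun_prop] SigmaOne.exists SigmaOne.forall_mem SigmaOne.forall_lt SigmaOne.initSeg_eq
  SigmaOne.oracle_eq

end SigmaOne

section Codes

open OracleCode

theorem OracleCode.encodeCode_injective : Function.Injective encodeCode := by
  intro c
  induction c with
  | zero | succ | left | right | oracle =>
    intro d h
    cases d <;> simp only [encodeCode] at h <;> first | rfl | omega
  | pair f g hf hg | comp f g hf hg | prec f g hf hg =>
    intro d h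
    cases d <;> simp only [encodeCode] at h <;> try omega
    obtain ⟨h1, h2⟩ := Nat.pair_eq_pair.1 (Nat.eq_of_mul_eq_mul_left (by simp) (add_right_cancel h))
    rw [hf h1, hg h2]
  | rfind' f hf =>
    intro d h
    cases d <;> simp only [encodeCode] at h <;> try omega
    rw [hf (Nat.eq_of_mul_eq_mul_left (by simp) (add_right_cancel h))]

theorem OracleCode.encodeCode_surjective : Function.Surjective encodeCode := by
  intro n
  induction n using Nat.strong_induction_on with
  | _ n ih =>
    rcases lt_or_ge n 5 with h | h
    · interval_cases n
      exacts [⟨.zero, rfl⟩, ⟨.succ, rfl⟩, ⟨.left, rfl⟩, ⟨.right, rfl⟩, ⟨.oracle, rfl⟩]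
    · have hlt : (n - 5) / 4 < n := by omega
      obtain ⟨c, hc⟩ := ih _ ((Nat.unpair_left_le _).trans_lt hlt)
      obtain ⟨d, hd⟩ := ih _ ((Nat.unpair_right_le _).trans_lt hlt)
      obtain ⟨e, he⟩ := ih _ hlt
      have hp : Nat.pair c.encodeCode d.encodeCode = (n - 5) / 4 := by
        rw [hc, hd, Nat.pair_unpair]
      have h4 : (n - 5) % 4 < 4 := Nat.mod_lt _ (by simp)
      interval_cases hr : (n - 5) % 4
      · exact ⟨.pair c d, by simp only [encodeCode]; omega⟩
      · exact ⟨.comp c d, by simp only [encodeCode]; omega⟩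
      · exact ⟨.prec c d, by simp only [encodeCode]; omega⟩
      · exact ⟨.rfind' e, by simp only [encodeCode]; omega⟩

instance : Countable OracleCode := encodeCode_injective.countable

variable {A : Set ℕ}

/-- The code `c` computes the total function `f` from the oracle `A`. -/
def Computes (A : Set ℕ) (c : OracleCode) (f : ℕ → ℕ) : Prop :=
  ∀ n, c.eval (chi A) n = Part.some (f n)

theorem Computes.pair {c d : OracleCode} {f g : ℕ → ℕ} (hc : Computes A c f)
    (hd : Computes A d g) : Computes A (.pair c d) fun n => Nat.pair (f n) (g n) := by
  intro n
  simp [eval, hc n, hd n, Seq.seq]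

theorem Computes.comp {c d : OracleCode} {f g : ℕ → ℕ} (hc : Computes A c f)
    (hd : Computes A d g) : Computes A (.comp c d) fun n => f (g n) := by
  intro n
  exact (congrArg (· >>= eval (chi A) c) (hd n)).trans ((Part.bind_some _ _).trans (hc _))

theorem computes_zero : Computes A .zero fun _ => 0 := fun _ => rfl

theorem computes_succ : Computes A .succ Nat.succ := fun _ => rfl

theorem computes_left : Computes A .left fun n => n.unpair.1 := fun _ => rfl

theorem computes_right : Computes A .right fun n => n.unpair.2 := fun _ => rfl

theorem computes_oracle : Computes A .oracle (chi A) := fun _ => rfl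

theorem computes_id : Computes A (.pair .left .right) fun n => n := by
  simpa using computes_left.pair (computes_right (A := A))

theorem Computes.prec {c d : OracleCode} {f g : ℕ → ℕ} (hc : Computes A c f)
    (hd : Computes A d g) : Computes A (.prec c d)
      (Nat.unpaired fun a n => n.rec (f a) fun y IH => g (Nat.pair a (Nat.pair y IH))) := by
  intro n
  simp only [eval, Nat.unpaired]
  generalize n.unpair.1 = a
  induction n.unpair.2 with
  | zero => exact hc a
  | succ k ih =>
    simp only [ih]
    simp [hd _]

theorem exists_computes_of_primrec {f : ℕ → ℕ} (hf : Primrec f) : ∃ c, Computes A c f := by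
  rw [Primrec.nat_iff] at hf
  induction hf with
  | zero => exact ⟨_, computes_zero⟩
  | succ => exact ⟨_, computes_succ⟩
  | left => exact ⟨_, computes_left⟩
  | right => exact ⟨_, computes_right⟩
  | pair _ _ hf hg =>
    obtain ⟨c, hc⟩ := hf
    obtain ⟨d, hd⟩ := hg
    exact ⟨_, hc.pair hd⟩
  | comp _ _ hf hg =>
    obtain ⟨c, hc⟩ := hf
    obtain ⟨d, hd⟩ := hg
    exact ⟨_, hc.comp hd⟩
  | prec _ _ hf hg =>
    obtain ⟨c, hc⟩ := hf
    obtain ⟨d, hd⟩ := hg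
    exact ⟨_, hc.prec hd⟩

theorem exists_computes_initSeg :
    ∃ c, Computes A c fun s => Encodable.encode (initSeg (chi A) s) := by
  let g : ℕ → ℕ := fun n => Encodable.encode
    (((Encodable.decode n.unpair.1 : Option (List ℕ)).getD []) ++ [n.unpair.2])
  have hg : Primrec g := by
    have : Primrec fun n : ℕ => (Encodable.decode n.unpair.1 : Option (List ℕ)).getD [] :=
      Primrec.option_getD.comp (by fun_prop) (by fun_prop)
    fun_prop
  obtain ⟨c, hc⟩ := exists_computes_of_primrec (A := A) hg
  have hstep := hc.comp ((computes_right.comp computes_right).pair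
    (computes_oracle.comp (computes_left.comp (computes_right (A := A)))))
  obtain ⟨d, hd⟩ := exists_computes_of_primrec (A := A)
    (Primrec.const (Encodable.encode ([] : List ℕ)))
  refine ⟨_, fun s => ((hd.prec hstep).comp (computes_zero.pair computes_id) s).trans ?_⟩
  congr 1
  simp only [Nat.unpaired, Nat.unpair_pair]
  induction s with
  | zero => simp [initSeg]
  | succ s ih =>
    simp only [ih]
    simp [g, initSeg_succ]

theorem OracleCode.mem_eval_rfind' {O : ℕ → ℕ} {c : OracleCode} {a k m : ℕ} :
    m ∈ eval O (.rfind' c) (Nat.pair a k) ↔ k ≤ m ∧ 0 ∈ eval O c (Nat.pair a m) ∧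
      ∀ i, k ≤ i → i < m → ∃ v, v + 1 ∈ eval O c (Nat.pair a i) := by
  have h1 : ∀ (q : Part ℕ) (b : Bool), b ∈ (fun m => decide (m = 0)) <$> q ↔
      ∃ v ∈ q, decide (v = 0) = b := fun q b => Part.mem_map_iff _
  simp only [eval, Nat.unpaired, Nat.unpair_pair]
  refine (Part.mem_map_iff _).trans ?_
  constructor
  · rintro ⟨n, hn, rfl⟩
    obtain ⟨h2, h3⟩ := Nat.mem_rfind.1 hn
    refine ⟨by omega, ?_, fun i h4 h5 => ?_⟩
    · obtain ⟨v, hv, hv0⟩ := (h1 _ _).1 h2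
      rwa [of_decide_eq_true hv0] at hv
    · obtain ⟨v, hv, hv0⟩ := (h1 _ _).1 (h3 (show i - k < n by omega))
      rw [Nat.sub_add_cancel h4] at hv
      have := of_decide_eq_false hv0
      exact ⟨v - 1, by rwa [Nat.sub_add_cancel (by omega)]⟩
  · rintro ⟨h2, h3, h4⟩
    refine ⟨m - k, Nat.mem_rfind.2 ⟨(h1 _ _).2 ⟨0, ?_, rfl⟩, fun {i} hi => ?_⟩, by omega⟩
    · rwa [Nat.sub_add_cancel h2]
    · obtain ⟨v, hv⟩ := h4 (i + k) (by omega) (by omega)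
      exact (h1 _ _).2 ⟨v + 1, hv, rfl⟩

theorem exists_code_least {R : ℕ → ℕ → List ℕ → Prop}
    (hR : PrimrecPred fun x : ℕ × ℕ × List ℕ => R x.1 x.2.1 x.2.2) :
    ∃ c : OracleCode, ∀ n s, s ∈ c.eval (chi A) n ↔
      R n s (initSeg (chi A) s) ∧ ∀ t < s, ¬ R n t (initSeg (chi A) t) := by
  classical
  let g : ℕ → ℕ := fun x => if R x.unpair.1.unpair.1 x.unpair.1.unpair.2
    ((Encodable.decode x.unpair.2 : Option (List ℕ)).getD []) then 0 else 1
  have hg : Primrec g := by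
    have : Primrec fun x : ℕ => (Encodable.decode x.unpair.2 : Option (List ℕ)).getD [] :=
      Primrec.option_getD.comp (by fun_prop) (by fun_prop)
    exact Primrec.ite (by fun_prop) (by fun_prop) (by fun_prop)
  obtain ⟨d, hd⟩ := exists_computes_of_primrec (A := A) hg
  obtain ⟨e, he⟩ := exists_computes_initSeg (A := A)
  have h := hd.comp (computes_id.pair (he.comp computes_right))
  refine ⟨.comp (.rfind' (.comp d (.pair (.pair .left .right) (.comp e .right))))
    (.pair (.pair .left .right) .zero), fun n s => ?_⟩
  have h0 : ∀ m, m ∈ eval (chi A) (.comp (.rfind' (.comp d (.pair (.pair .left .right)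
      (.comp e .right)))) (.pair (.pair .left .right) .zero)) n ↔ m ∈ eval (chi A) (.rfind'
      (.comp d (.pair (.pair .left .right) (.comp e .right)))) (Nat.pair n 0) := by
    intro m
    refine Part.mem_bind_iff.trans ?_
    rw [(computes_id (A := A)).pair computes_zero n]
    simp
  have h' : ∀ t m, m ∈ eval (chi A) (.comp d (.pair (.pair .left .right) (.comp e .right)))
      (Nat.pair n t) ↔ m = if R n t (initSeg (chi A) t) then 0 else 1 := by
    intro t m
    rw [h]
    simp [g]
  rw [h0, mem_eval_rfind']
  simp only [h', zero_le, true_and, forall_const]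
  refine and_congr ?_ (forall₂_congr fun t _ => ?_)
  · by_cases hh : R n s (initSeg (chi A) s) <;> simp [hh]
  · by_cases hh : R n t (initSeg (chi A) t) <;> simp [hh]

theorem SigmaOne.exists_code {α : Type*} [Primcodable α] {p : α → Prop} (hp : SigmaOne A p) :
    ∃ c : OracleCode, ∀ a, p a ↔ (c.eval (chi A) (Encodable.encode a)).Dom := by
  have hp' : SigmaOne A fun n : ℕ => ∃ a : α, Encodable.encode a = n ∧ p a := by fun_prop
  obtain ⟨r, hr, h⟩ := hp'
  obtain ⟨c, hc⟩ := exists_code_least (A := A) (R := fun n _ τ => r n τ) (by fun_prop)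
  refine ⟨c, fun a => ?_⟩
  classical
  rw [Part.dom_iff_mem]
  simp only [hc]
  trans ∃ s, r (Encodable.encode a) (initSeg (chi A) s)
  · rw [← h]
    simp
  · exact ⟨fun h => ⟨Nat.find h, Nat.find_spec h, fun t ht => Nat.find_min h ht⟩,
      fun ⟨s, hs, _⟩ => ⟨s, hs⟩⟩

theorem SigmaOne.recursiveIn {f : ℕ → ℕ} (hf : SigmaOne A fun x : ℕ × ℕ => f x.1 = x.2) :
    RecursiveIn (chi A) f := by
  obtain ⟨r, hr, hrm, h⟩ := hf.exists_mono
  obtain ⟨c, hc⟩ := exists_code_least (A := A)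
    (R := fun n s τ => r (n, s.unpair.1) (τ.take s.unpair.2)) (by fun_prop)
  classical
  have hex : ∀ n, ∃ s, s ∈ c.eval (chi A) n := by
    intro n
    obtain ⟨t, ht⟩ := (h (n, f n)).1 rfl
    have hex : ∃ s : ℕ, r (n, s.unpair.1) ((initSeg (chi A) s).take s.unpair.2) :=
      ⟨Nat.pair (f n) t, by simpa [take_initSeg _ (Nat.right_le_pair _ _)] using ht⟩
    exact ⟨Nat.find hex, (hc _ _).2 ⟨Nat.find_spec hex, fun t ht => Nat.find_min hex ht⟩⟩
  refine ⟨.comp .left c, funext fun n => ?_⟩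
  obtain ⟨s, hs⟩ := hex n
  have h1 := ((hc _ _).1 hs).1
  rw [take_initSeg _ (Nat.unpair_right_le s)] at h1
  have h2 : f n = s.unpair.1 := (h (n, s.unpair.1)).2 ⟨_, h1⟩
  exact (congrArg (· >>= eval (chi A) .left) (Part.eq_some_iff.2 hs)).trans
    ((Part.bind_some _ _).trans (congrArg Part.some h2.symm))

/-- The triple `(e, n, m)` (read as: the code numbered `e` maps `n` to `m`) follows in one step
from the triples in `D`. -/
def Justified (A : Set ℕ) (x : ℕ × ℕ × ℕ) (D : List (ℕ × ℕ × ℕ)) : Prop :=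
  (x.1 = 0 ∧ x.2.2 = 0) ∨ (x.1 = 1 ∧ x.2.2 = x.2.1 + 1) ∨ (x.1 = 2 ∧ x.2.2 = x.2.1.unpair.1) ∨
  (x.1 = 3 ∧ x.2.2 = x.2.1.unpair.2) ∨ (x.1 = 4 ∧ chi A x.2.1 = x.2.2) ∨
  (∃ f g u v, x.1 = 4 * Nat.pair f g + 5 ∧ (f, x.2.1, u) ∈ D ∧ (g, x.2.1, v) ∈ D ∧
    x.2.2 = Nat.pair u v) ∨
  (∃ f g u, x.1 = 4 * Nat.pair f g + 6 ∧ (g, x.2.1, u) ∈ D ∧ (f, u, x.2.2) ∈ D) ∨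
  (∃ f g a, x.1 = 4 * Nat.pair f g + 7 ∧ x.2.1 = Nat.pair a 0 ∧ (f, a, x.2.2) ∈ D) ∨
  (∃ f g a k i, x.1 = 4 * Nat.pair f g + 7 ∧ x.2.1 = Nat.pair a (k + 1) ∧
    (x.1, Nat.pair a k, i) ∈ D ∧ (g, Nat.pair a (Nat.pair k i), x.2.2) ∈ D) ∨
  (∃ f a, x.1 = 4 * f + 8 ∧ x.2.1 = Nat.pair a x.2.2 ∧ (f, Nat.pair a x.2.2, 0) ∈ D) ∨
  (∃ f a m v, x.1 = 4 * f + 8 ∧ x.2.1 = Nat.pair a m ∧ (f, Nat.pair a m, v + 1) ∈ D ∧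
    (x.1, Nat.pair a (m + 1), x.2.2) ∈ D)

/-- Every triple in the list is justified by the later ones. -/
def Valid (A : Set ℕ) : List (ℕ × ℕ × ℕ) → Prop
  | [] => True
  | x :: D => Justified A x D ∧ Valid A D

theorem Justified.mono {x : ℕ × ℕ × ℕ} {D E : List (ℕ × ℕ × ℕ)} (h : Justified A x D)
    (hDE : D ⊆ E) : Justified A x E := by
  rcases h with h | h | h | h | h | ⟨f, g, u, v, h1, h2, h3, h4⟩ | ⟨f, g, u, h1, h2, h3⟩ |
    ⟨f, g, a, h1, h2, h3⟩ | ⟨f, g, a, k, i, h1, h2, h3, h4⟩ | ⟨f, a, h1, h2, h3⟩ |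
    ⟨f, a, m, v, h1, h2, h3, h4⟩
  · exact .inl h
  · exact .inr (.inl h)
  · exact .inr (.inr (.inl h))
  · exact .inr (.inr (.inr (.inl h)))
  · exact .inr (.inr (.inr (.inr (.inl h))))
  · exact .inr (.inr (.inr (.inr (.inr (.inl ⟨f, g, u, v, h1, hDE h2, hDE h3, h4⟩)))))
  · exact .inr (.inr (.inr (.inr (.inr (.inr (.inl ⟨f, g, u, h1, hDE h2, hDE h3⟩))))))
  · exact .inr (.inr (.inr (.inr (.inr (.inr (.inr (.inl ⟨f, g, a, h1, h2, hDE h3⟩)))))))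
  · exact .inr (.inr (.inr (.inr (.inr (.inr (.inr (.inr (.inl
      ⟨f, g, a, k, i, h1, h2, hDE h3, hDE h4⟩))))))))
  · exact .inr (.inr (.inr (.inr (.inr (.inr (.inr (.inr (.inr (.inl
      ⟨f, a, h1, h2, hDE h3⟩)))))))))
  · exact .inr (.inr (.inr (.inr (.inr (.inr (.inr (.inr (.inr (.inr
      ⟨f, a, m, v, h1, h2, hDE h3, hDE h4⟩)))))))))

theorem Valid.append {D E : List (ℕ × ℕ × ℕ)} (hD : Valid A D) (hE : Valid A E) :
    Valid A (D ++ E) := by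
  induction D with
  | nil => exact hE
  | cons x D ih => exact ⟨hD.1.mono (by simp), ih hD.2⟩

theorem valid_iff (D : List (ℕ × ℕ × ℕ)) :
    Valid A D ↔ ∀ i, i < D.length → ∃ x, D[i]? = some x ∧ Justified A x (D.drop (i + 1)) := by
  induction D with
  | nil => simp [Valid]
  | cons x D ih => 
    rw [Valid, ih]
    constructor
    · rintro ⟨h1, h2⟩ (_ | i) hi
      · exact ⟨x, by simp, by simpa using h1⟩
      · simpa using h2 i (by simpa using hi)
    · intro h
      exact ⟨by simpa using h 0 (by simp), fun i hi => by simpa using h (i + 1) (by simpa using hi)⟩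

theorem OracleCode.mem_eval_prec_zero {O : ℕ → ℕ} {c d : OracleCode} {a m : ℕ} :
    m ∈ eval O (.prec c d) (Nat.pair a 0) ↔ m ∈ eval O c a := by
  simp [eval]

theorem OracleCode.mem_eval_prec_succ {O : ℕ → ℕ} {c d : OracleCode} {a k m : ℕ} :
    m ∈ eval O (.prec c d) (Nat.pair a (k + 1)) ↔
      ∃ i ∈ eval O (.prec c d) (Nat.pair a k), m ∈ eval O d (Nat.pair a (Nat.pair k i)) := by
  simp [eval]

theorem Valid.sound {D : List (ℕ × ℕ × ℕ)} (hD : Valid A D) :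
    ∀ x ∈ D, ∀ c : OracleCode, c.encodeCode = x.1 → x.2.2 ∈ c.eval (chi A) x.2.1 := by
  induction D with
  | nil => simp
  | cons y D ih =>
    have ih := ih hD.2
    intro x hx c hc
    rcases List.mem_cons.1 hx with rfl | hx
    swap
    · exact ih x hx c hc
    obtain ⟨e, n, m⟩ := x
    have hj := hD.1
    simp only [Justified] at hc hj ⊢
    have key : ∀ {c : OracleCode} {e n m : ℕ}, (e, n, m) ∈ D → c.encodeCode = e →
      m ∈ c.eval (chi A) n := fun h1 h2 => ih _ h1 _ h2
    rcases hj with ⟨h1, rfl⟩ | ⟨h1, rfl⟩ | ⟨h1, rfl⟩ | ⟨h1, rfl⟩ | ⟨h1, rfl⟩ |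
      ⟨f, g, u, v, h1, h2, h3, rfl⟩ | ⟨f, g, u, h1, h2, h3⟩ |
      ⟨f, g, a, h1, rfl, h3⟩ | ⟨f, g, a, k, i, h1, rfl, h3, h4⟩ | ⟨f, a, h1, rfl, h3⟩ |
      ⟨f, a, k, v, h1, rfl, h3, h4⟩
    · obtain rfl : c = .zero := encodeCode_injective (hc.trans h1)
      simp [eval, pure, PFun.pure]
    · obtain rfl : c = .succ := encodeCode_injective (hc.trans h1)
      simp [eval]
    · obtain rfl : c = .left := encodeCode_injective (hc.trans h1)
      simp [eval]
    · obtain rfl : c = .right := encodeCode_injective (hc.trans h1)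
      simp [eval]
    · obtain rfl : c = .oracle := encodeCode_injective (hc.trans h1)
      simp [eval]
    all_goals obtain ⟨f, rfl⟩ := encodeCode_surjective f
    · obtain ⟨g, rfl⟩ := encodeCode_surjective g
      obtain rfl : c = .pair f g := encodeCode_injective (hc.trans h1)
      simp only [eval, Part.eq_some_iff.2 (key h2 rfl), Part.eq_some_iff.2 (key h3 rfl)]
      simp [Seq.seq]
    · obtain ⟨g, rfl⟩ := encodeCode_surjective g
      obtain rfl : c = .comp f g := encodeCode_injective (hc.trans h1)
      exact Part.mem_bind (key h2 rfl) (key h3 rfl)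
    · obtain ⟨g, rfl⟩ := encodeCode_surjective g
      obtain rfl : c = .prec f g := encodeCode_injective (hc.trans h1)
      exact mem_eval_prec_zero.2 (key h3 rfl)
    · obtain ⟨g, rfl⟩ := encodeCode_surjective g
      obtain rfl : c = .prec f g := encodeCode_injective (hc.trans h1)
      exact mem_eval_prec_succ.2 ⟨i, key h3 hc, key h4 rfl⟩
    · obtain rfl : c = .rfind' f := encodeCode_injective (hc.trans h1)
      exact mem_eval_rfind'.2 ⟨le_rfl, key h3 rfl, fun i h5 h6 => by omega⟩
    · obtain rfl : c = .rfind' f := encodeCode_injective (hc.trans h1)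
      obtain ⟨h5, h6, h7⟩ := mem_eval_rfind'.1 (key h4 hc)
      refine mem_eval_rfind'.2 ⟨by omega, h6, fun i h8 h9 => ?_⟩
      rcases h8.eq_or_lt with rfl | h8
      · exact ⟨v, key h3 rfl⟩
      · exact h7 i h8 h9

theorem exists_valid (c : OracleCode) : ∀ n m, m ∈ c.eval (chi A) n →
    ∃ D, Valid A D ∧ (c.encodeCode, n, m) ∈ D := by
  have key : ∀ {x D}, Valid A D → Justified A x D → ∃ D, Valid A D ∧ x ∈ D :=
    fun {x D} h1 h2 => ⟨x :: D, ⟨h2, h1⟩, by simp⟩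
  induction c with
  | zero =>
    intro n m h
    exact key (D := []) trivial (.inl ⟨rfl, by simpa [eval, pure, PFun.pure] using h⟩)
  | succ =>
    intro n m h
    exact key (D := []) trivial (.inr (.inl ⟨rfl, by simpa [eval] using h⟩))
  | left =>
    intro n m h
    exact key (D := []) trivial (.inr (.inr (.inl ⟨rfl, by simpa [eval] using h⟩)))
  | right =>
    intro n m h
    exact key (D := []) trivial (.inr (.inr (.inr (.inl ⟨rfl, by simpa [eval] using h⟩))))
  | oracle =>
    intro n m h
    exact key (D := []) trivial
      (.inr (.inr (.inr (.inr (.inl ⟨rfl, by simpa [eval, eq_comm] using h⟩)))))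
  | pair f g hf hg =>
    intro n m h
    have h' : ∃ u v, u ∈ eval (chi A) f n ∧ v ∈ eval (chi A) g n ∧ m = Nat.pair u v := by
      simpa [eval, Seq.seq, eq_comm, and_assoc] using h
    obtain ⟨u, v, hu, hv, h⟩ := h'
    obtain ⟨D, hD, h1⟩ := hf _ _ hu
    obtain ⟨E, hE, h2⟩ := hg _ _ hv
    exact key (hD.append hE) (.inr (.inr (.inr (.inr (.inr (.inl
      ⟨_, _, u, v, rfl, by simp [h1], by simp [h2], h⟩))))))
  | comp f g hf hg =>
    intro n m h
    obtain ⟨u, hu, hv⟩ := Part.mem_bind_iff.1 h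
    obtain ⟨D, hD, h1⟩ := hg _ _ hu
    obtain ⟨E, hE, h2⟩ := hf _ _ hv
    exact key (hD.append hE) (.inr (.inr (.inr (.inr (.inr (.inr (.inl
      ⟨_, _, u, rfl, by simp [h1], by simp [h2]⟩)))))))
  | prec f g hf hg =>
    intro n
    obtain ⟨⟨a, k⟩, rfl⟩ := Nat.pairEquiv.surjective n
    simp only [Nat.pairEquiv_apply, Function.uncurry]
    induction k with
    | zero =>
      intro m h
      obtain ⟨D, hD, h1⟩ := hf _ _ (mem_eval_prec_zero.1 h)
      exact key hD (.inr (.inr (.inr (.inr (.inr (.inr (.inr (.inl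
        ⟨_, _, a, rfl, rfl, h1⟩))))))))
    | succ k ih =>
      intro m h
      obtain ⟨i, hi, h⟩ := mem_eval_prec_succ.1 h
      obtain ⟨D, hD, h1⟩ := ih _ hi
      obtain ⟨E, hE, h2⟩ := hg _ _ h
      exact key (hD.append hE) (.inr (.inr (.inr (.inr (.inr (.inr (.inr (.inr (.inl
        ⟨_, _, a, k, i, rfl, rfl, List.mem_append_left _ h1, List.mem_append_right _ h2⟩)))))))))
  | rfind' f hf =>
    intro n
    obtain ⟨⟨a, k⟩, rfl⟩ := Nat.pairEquiv.surjective n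
    simp only [Nat.pairEquiv_apply, Function.uncurry]
    intro m h
    obtain ⟨h1, h2, h3⟩ := mem_eval_rfind'.1 h
    clear h
    induction h1 using Nat.decreasingInduction with
    | self =>
      obtain ⟨D, hD, h1⟩ := hf _ _ h2
      exact key hD (.inr (.inr (.inr (.inr (.inr (.inr (.inr (.inr (.inr (.inl
        ⟨_, a, rfl, rfl, h1⟩))))))))))
    | of_succ k hk ih =>
      obtain ⟨D, hD, h1⟩ := ih fun i h4 h5 => h3 i (by omega) h5
      obtain ⟨v, hv⟩ := h3 k le_rfl hk
      obtain ⟨E, hE, h2⟩ := hf _ _ hv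
      exact key (hD.append hE) (.inr (.inr (.inr (.inr (.inr (.inr (.inr (.inr (.inr (.inr
        ⟨_, a, k, v, rfl, rfl, List.mem_append_right _ h2, List.mem_append_left _ h1⟩))))))))))

theorem mem_eval_iff (c : OracleCode) (n m : ℕ) : m ∈ c.eval (chi A) n ↔
    ∃ D : List (ℕ × ℕ × ℕ), (∀ i, i < D.length →
        ∃ x, D[i]? = some x ∧ Justified A x (D.drop (i + 1))) ∧
      (c.encodeCode, n, m) ∈ D := by
  simp only [← valid_iff]
  exact ⟨exists_valid c n m, fun ⟨D, hD, h⟩ => hD.sound _ h c rfl⟩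

@[fun_prop]
theorem primrecPred_mem {α β : Type*} [Primcodable α] [Primcodable β] {f : α → β}
    {l : α → List β} (hf : Primrec f) (hl : Primrec l) : PrimrecPred fun a => f a ∈ l a := by
  have : PrimrecPred fun a => ∃ b, b ∈ l a ∧ b = f a := by fun_prop
  simpa using this

theorem sigmaOne_justified :
    SigmaOne A fun x : (ℕ × ℕ × ℕ) × List (ℕ × ℕ × ℕ) => Justified A x.1 x.2 := by
  unfold Justified
  fun_prop

theorem sigmaOne_mem_eval : SigmaOne A fun x : ℕ × ℕ × ℕ =>
    ∃ c : OracleCode, c.encodeCode = x.1 ∧ x.2.2 ∈ c.eval (chi A) x.2.1 := by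
  have h := sigmaOne_justified (A := A)
  have h' : SigmaOne A fun x : ℕ × ℕ × ℕ => ∃ D : List (ℕ × ℕ × ℕ), (∀ i, i < D.length →
        ∃ x, D[i]? = some x ∧ Justified A x (D.drop (i + 1))) ∧ x ∈ D := by
    have h1 : SigmaOne A fun y : ((ℕ × ℕ × ℕ) × List (ℕ × ℕ × ℕ)) × ℕ =>
      ∃ x, y.1.2[y.2]? = some x ∧ Justified A x (y.1.2.drop (y.2 + 1)) := by
      refine SigmaOne.exists (SigmaOne.and (by fun_prop) ?_)
      exact h.comp (f := fun y : (((ℕ × ℕ × ℕ) × List (ℕ × ℕ × ℕ)) × ℕ) × (ℕ × ℕ × ℕ) =>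
        (y.2, y.1.1.2.drop (y.1.2 + 1))) (by fun_prop)
    exact SigmaOne.exists (SigmaOne.and (SigmaOne.forall_lt h1 (by fun_prop)) (by fun_prop))
  refine h'.of_iff fun x => ?_
  obtain ⟨c, hc⟩ := encodeCode_surjective x.1
  constructor
  · rintro ⟨d, hd, h⟩
    rw [mem_eval_iff, hd] at h
    exact h
  · intro h
    exact ⟨c, hc, (mem_eval_iff c _ _).2 (by rw [hc]; exact h)⟩

theorem sigmaOne_eval_dom (c : OracleCode) :
    SigmaOne A fun n : ℕ => (c.eval (chi A) n).Dom := by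
  have : SigmaOne A fun n : ℕ => ∃ m : ℕ, ∃ d : OracleCode, d.encodeCode = (c.encodeCode, n, m).1 ∧
      (c.encodeCode, n, m).2.2 ∈ d.eval (chi A) (c.encodeCode, n, m).2.1 :=
    SigmaOne.exists (sigmaOne_mem_eval.comp
      (f := fun x : ℕ × ℕ => (c.encodeCode, x.1, x.2)) (by fun_prop))
  refine this.of_iff fun n => Part.dom_iff_mem.trans (exists_congr fun m => ?_)
  exact ⟨fun h => ⟨c, rfl, h⟩, fun ⟨d, hd, h⟩ => encodeCode_injective hd ▸ h⟩

theorem sigmaOne_jump : SigmaOne A fun e => e ∈ jump A := by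
  have : SigmaOne A fun n : ℕ => ∃ m : ℕ, ∃ d : OracleCode, d.encodeCode = (n, n, m).1 ∧
      (n, n, m).2.2 ∈ d.eval (chi A) (n, n, m).2.1 :=
    SigmaOne.exists (sigmaOne_mem_eval.comp
      (f := fun x : ℕ × ℕ => (x.1, x.1, x.2)) (by fun_prop))
  refine this.of_iff fun n => ?_
  simp only [jump, Set.mem_ofPred_eq, Part.dom_iff_mem]
  exact ⟨fun ⟨c, hc, m, hm⟩ => ⟨m, c, hc, hm⟩, fun ⟨m, c, hc, hm⟩ => ⟨c, hc, m, hm⟩⟩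

theorem ceIn_iff {W : Set (List Bool)} : CeIn A W ↔ SigmaOne A (· ∈ W) := by
  constructor
  · rintro ⟨c, hc⟩
    exact ((sigmaOne_eval_dom c).comp (f := Encodable.encode) (by fun_prop)).of_iff hc
  · exact fun h => h.exists_code

theorem ceSeqIn_iff {W : ℕ → Set (List Bool)} :
    CeSeqIn A W ↔ SigmaOne A fun x : ℕ × List Bool => x.2 ∈ W x.1 := by
  constructor
  · rintro ⟨c, hc⟩
    exact ((sigmaOne_eval_dom c).comp (f := fun x : ℕ × List Bool =>
      Nat.pair x.1 (Encodable.encode x.2)) (by fun_prop)).of_iff fun x => hc x.1 x.2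
  · intro h
    obtain ⟨c, hc⟩ := h.exists_code
    exact ⟨c, fun n σ => hc (n, σ)⟩

end Codes

section Limit

open OracleCode

variable {α : Type*} [Primcodable α] {A B : Set ℕ}

theorem chi_eq_one_iff {n : ℕ} : chi A n = 1 ↔ n ∈ A := by
  classical
  by_cases h : n ∈ A <;> simp [chi, h]

theorem chi_eq_zero_iff {n : ℕ} : chi A n = 0 ↔ n ∉ A := by
  classical
  by_cases h : n ∈ A <;> simp [chi, h]

theorem SigmaOne.exists_not_of_jump {p : α → Prop} (hp : SigmaOne (jump B) p) :
    ∃ q : α → ℕ → Prop, SigmaOne B (fun x : α × ℕ => q x.1 x.2) ∧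
      ∀ a, p a ↔ ∃ k, ¬ q a k := by
  obtain ⟨r, hr, h⟩ := hp
  have hj := sigmaOne_jump (A := B)
  obtain ⟨ρ, hρ, hj'⟩ := sigmaOne_jump (A := B)
  let q : α → List ℕ × ℕ → Prop := fun a w => ¬ r a w.1 ∨ ∃ υ : List ℕ, υ = initSeg (chi B) w.2 ∧
    ∃ i : ℕ, i < w.1.length ∧ (¬ w.1[i]? = some 1 ∨ ∀ j, j < υ.length + 1 → ¬ ρ i (υ.take j)) ∧
      (¬ w.1[i]? = some 0 ∨ i ∈ jump B)
  have hq : SigmaOne B fun x : α × (List ℕ × ℕ) => q x.1 x.2 := by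
    refine SigmaOne.or (PrimrecPred.sigmaOne (by fun_prop)) (SigmaOne.exists
      (SigmaOne.and (by fun_prop) (SigmaOne.exists (SigmaOne.and (by fun_prop)
        (SigmaOne.and ?_ (SigmaOne.or (PrimrecPred.sigmaOne (by fun_prop)) ?_))))))
    · exact PrimrecPred.sigmaOne (by fun_prop)
    · exact hj.comp (f := fun x : ((α × List ℕ × ℕ) × List ℕ) × ℕ => x.2) (by fun_prop)
  have key : ∀ a, p a ↔ ∃ w, ¬ q a w := by
    intro a
    rw [h]
    simp only [q, not_or, not_not, not_exists, not_and]
    constructor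
    · rintro ⟨s, hs⟩
      have : ∀ n, ∃ t, ∀ i < n, i ∈ jump B → ∃ j ≤ t, ρ i (initSeg (chi B) j) := by
        intro n
        induction n with
        | zero => simp
        | succ n ih =>
          obtain ⟨t, ht⟩ := ih
          by_cases hn : n ∈ jump B
          · obtain ⟨u, hu⟩ := (hj' n).1 hn
            refine ⟨max t u, fun i hi hij => ?_⟩
            rcases Nat.lt_succ_iff_lt_or_eq.1 hi with hi | rfl
            · obtain ⟨j, h1, h2⟩ := ht i hi hij
              exact ⟨j, by omega, h2⟩
            · exact ⟨u, by omega, hu⟩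
          · refine ⟨t, fun i hi hij => ht i ?_ hij⟩
            rcases Nat.lt_succ_iff_lt_or_eq.1 hi with hi | rfl
            · exact hi
            · exact absurd hij hn
      obtain ⟨t, ht⟩ := this s
      refine ⟨(initSeg (chi (jump B)) s, t), hs, fun υ hυ i hi hi1 => ?_⟩
      subst hυ
      simp only [length_initSeg] at hi
      simp only [getElem?_initSeg _ hi, Option.some.injEq, chi_eq_one_iff, chi_eq_zero_iff] at hi1 ⊢
      have hn : i ∉ jump B := by
        intro hij
        obtain ⟨j, h1, h2⟩ := ht i hi hij
        rcases hi1 with hi1 | hi1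
        · exact hi1 hij
        · refine hi1 j (by simp; omega) ?_
          rwa [take_initSeg _ h1]
      exact ⟨hn, hn⟩
    · rintro ⟨⟨τ, t⟩, h1, h2⟩
      refine ⟨τ.length, ?_⟩
      rwa [← (eq_initSeg_iff _).2 fun i hi => ?_]
      by_cases hij : i ∈ jump B
      · rw [chi_eq_one_iff.2 hij]
        by_contra hc
        exact (h2 _ rfl i hi (.inl hc)).2 hij
      · rw [chi_eq_zero_iff.2 hij]
        refine (h2 _ rfl i hi (.inr fun j hj hρ => hij ?_)).1
        simp only [length_initSeg] at hj
        rw [take_initSeg _ (by omega)] at hρ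
        exact (hj' i).2 ⟨j, hρ⟩
  refine ⟨fun a k => ∀ w, w ∈ (Encodable.decode (α := List ℕ × ℕ) k).toList → q a w,
    SigmaOne.forall_mem ?_ ?_, fun a => ?_⟩
  · exact hq.comp (f := fun x : (α × ℕ) × (List ℕ × ℕ) => (x.1.1, x.2)) (by fun_prop)
  · exact Primrec.optionToList.comp (by fun_prop)
  · rw [key]
    constructor
    · rintro ⟨w, hw⟩
      exact ⟨Encodable.encode w, fun hk => hw (hk w (by rw [Encodable.encodek]; simp))⟩
    · rintro ⟨k, hk⟩
      push Not at hk
      obtain ⟨w, -, hw⟩ := hk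
      exact ⟨w, hw⟩

/-- A set computable from the jump of `B` is `Δ₂` relative to `B`. -/
theorem TuringLE.exists_not (h : TuringLE A (jump B)) :
    ∃ q₁ q₀ : ℕ → ℕ → Prop, SigmaOne B (fun x : ℕ × ℕ => q₁ x.1 x.2) ∧
      SigmaOne B (fun x : ℕ × ℕ => q₀ x.1 x.2) ∧ (∀ n, n ∈ A ↔ ∃ k, ¬ q₁ n k) ∧
      ∀ n, n ∉ A ↔ ∃ k, ¬ q₀ n k := by
  obtain ⟨c, hc⟩ := h
  have hgraph : SigmaOne (jump B) fun x : ℕ × ℕ => chi A x.1 = x.2 := by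
    have : SigmaOne (jump B) fun x : ℕ × ℕ => ∃ d : OracleCode,
        d.encodeCode = (c.encodeCode, x.1, x.2).1 ∧
          (c.encodeCode, x.1, x.2).2.2 ∈ d.eval (chi (jump B)) (c.encodeCode, x.1, x.2).2.1 :=
      sigmaOne_mem_eval.comp (f := fun x : ℕ × ℕ => (c.encodeCode, x.1, x.2)) (by fun_prop)
    refine this.of_iff fun x => ?_
    constructor
    · intro h
      exact ⟨c, rfl, by simp [hc, h]⟩
    · rintro ⟨d, hd, h⟩
      obtain rfl := encodeCode_injective hd
      simpa [hc, eq_comm] using h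
  obtain ⟨q₁, h1, h1'⟩ := (hgraph.comp (f := fun n : ℕ => (n, 1)) (by fun_prop)).exists_not_of_jump
  obtain ⟨q₀, h0, h0'⟩ := (hgraph.comp (f := fun n : ℕ => (n, 0)) (by fun_prop)).exists_not_of_jump
  exact ⟨q₁, q₀, h1, h0, fun n => by rw [← h1', chi_eq_one_iff],
    fun n => by rw [← h0', chi_eq_zero_iff]⟩

theorem SigmaOne.exists_mem_jump {q : α → Prop} (hq : SigmaOne B q) :
    ∃ e : α → ℕ, Primrec e ∧ ∀ a, q a ↔ e a ∈ jump B := by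
  obtain ⟨c, hc⟩ := hq.exists_code
  let E : ℕ → OracleCode := fun x => Nat.rec .zero (fun _ d => .comp .succ d) x
  have hE : ∀ x, Computes B (E x) fun _ => x := by
    intro x
    induction x with
    | zero => exact computes_zero
    | succ x ih => exact computes_succ.comp ih
  have hEp : Primrec fun x => (E x).encodeCode := by
    have : Primrec fun x : ℕ => (Nat.rec 0 (fun _ d => 4 * Nat.pair 1 d + 6) x : ℕ) :=
      Primrec.nat_rec₁ 0 (show Primrec fun x : ℕ × ℕ => 4 * Nat.pair 1 x.2 + 6 by fun_prop)
    refine this.of_eq fun x => ?_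
    induction x with
    | zero => rfl
    | succ x ih => simp only [ih, E, encodeCode]
  refine ⟨fun a => (OracleCode.comp c (E (Encodable.encode a))).encodeCode, ?_, fun a => ?_⟩
  · simp only [encodeCode]
    have := hEp.comp (Primrec.encode (α := α))
    fun_prop
  · have h : ∀ n, (OracleCode.comp c (E (Encodable.encode a))).eval (chi B) n =
        c.eval (chi B) (Encodable.encode a) := fun n =>
      (congrArg (· >>= eval (chi B) c) (hE _ n)).trans (Part.bind_some _ _)
    rw [hc]
    constructor
    · intro hd
      exact ⟨_, rfl, by rwa [h]⟩
    · rintro ⟨d, hd, hdom⟩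
      obtain rfl := encodeCode_injective hd
      rwa [h] at hdom

theorem SigmaOne.not_of_jump {q : α → Prop} (hq : SigmaOne B q) :
    SigmaOne (jump B) fun a => ¬ q a := by
  obtain ⟨e, he, h⟩ := hq.exists_mem_jump
  have : SigmaOne (jump B) fun a => chi (jump B) (e a) = 0 := by fun_prop
  exact this.of_iff fun a => by rw [h, chi_eq_zero_iff]

/-- A set that is `Δ₂` relative to `B` is computable from the jump of `B`. -/
theorem turingLE_jump_of_exists_not {q₁ q₀ : ℕ → ℕ → Prop}
    (h₁ : SigmaOne B fun x : ℕ × ℕ => q₁ x.1 x.2) (h₀ : SigmaOne B fun x : ℕ × ℕ => q₀ x.1 x.2)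
    (h₁' : ∀ n, n ∈ A ↔ ∃ k, ¬ q₁ n k) (h₀' : ∀ n, n ∉ A ↔ ∃ k, ¬ q₀ n k) :
    TuringLE A (jump B) := by
  have key : ∀ {q : ℕ → ℕ → Prop}, SigmaOne B (fun x : ℕ × ℕ => q x.1 x.2) →
      SigmaOne (jump B) fun x : ℕ × ℕ => ∃ k, ¬ q x.1 k := fun h =>
    SigmaOne.exists (h.not_of_jump.comp (f := fun x : (ℕ × ℕ) × ℕ => (x.1.1, x.2)) (by fun_prop))
  have h : SigmaOne (jump B) fun x : ℕ × ℕ =>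
      ((∃ k, ¬ q₁ x.1 k) ∧ x.2 = 1) ∨ ((∃ k, ¬ q₀ x.1 k) ∧ x.2 = 0) :=
    SigmaOne.or (SigmaOne.and (key h₁) (by fun_prop)) (SigmaOne.and (key h₀) (by fun_prop))
  have hg : SigmaOne (jump B) fun x : ℕ × ℕ => chi A x.1 = x.2 := by
    refine h.of_iff fun x => ?_
    rw [← h₁', ← h₀']
    by_cases hx : x.1 ∈ A
    · simp [hx, chi_eq_one_iff.2 hx, eq_comm]
    · simp [hx, chi_eq_zero_iff.2 hx, eq_comm]
  exact hg.recursiveIn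

end Limit

section Measure

open scoped ENNReal

theorem mem_cyl_singleton {σ : List Bool} {X : ℕ → Bool} :
    X ∈ Cyl {σ} ↔ σ = initSeg X σ.length := by
  rw [eq_initSeg_iff]
  simp only [Cyl, Set.mem_singleton_iff, exists_eq_left, Set.mem_ofPred_eq, Fin.forall_iff]
  refine forall₂_congr fun i hi => ?_
  rw [List.getElem?_eq_getElem hi]
  simp [eq_comm]

theorem cyl_eq_biUnion (W : Set (List Bool)) : Cyl W = ⋃ σ ∈ W, Cyl {σ} := by
  ext X
  simp [Cyl]

theorem mem_cyl {W : Set (List Bool)} {X : ℕ → Bool} : X ∈ Cyl W ↔ ∃ n, initSeg X n ∈ W := by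
  rw [cyl_eq_biUnion]
  simp only [Set.mem_iUnion, mem_cyl_singleton, exists_prop]
  constructor
  · rintro ⟨σ, h1, h2⟩
    exact ⟨_, h2 ▸ h1⟩
  · rintro ⟨n, h⟩
    exact ⟨_, h, by simp⟩

theorem cyl_mono {V W : Set (List Bool)} (h : V ⊆ W) : Cyl V ⊆ Cyl W :=
  fun _ ⟨σ, h1, h2⟩ => ⟨σ, h h1, h2⟩

theorem isOpen_cyl (W : Set (List Bool)) : IsOpen (Cyl W) := by
  have : Cyl W = ⋃ σ ∈ W, ⋂ i : Fin σ.length, (fun X : ℕ → Bool => X i) ⁻¹' {σ.get i} := by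
    ext X
    simp [Cyl]
  rw [this]
  exact isOpen_biUnion fun σ _ => isOpen_iInter_of_finite fun i =>
    (isOpen_discrete _).preimage (continuous_apply _)

theorem measurableSet_cyl (W : Set (List Bool)) : MeasurableSet (Cyl W) :=
  (isOpen_cyl W).measurableSet

theorem initSeg_eq_of_le {X Y : ℕ → Bool} {m n : ℕ} (h : initSeg X n = initSeg Y n) (hm : m ≤ n) :
    initSeg X m = initSeg Y m := by
  rw [← take_initSeg X hm, h, take_initSeg Y hm]

theorem cyl_singleton_subset {σ τ : List Bool} (h : (Cyl {σ} ∩ Cyl {τ}).Nonempty)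
    (hl : τ.length ≤ σ.length) : Cyl {σ} ⊆ Cyl {τ} := by
  obtain ⟨X, h1, h2⟩ := h
  intro Y hY
  rw [mem_cyl_singleton] at *
  rw [h2]
  simp only [length_initSeg]
  exact initSeg_eq_of_le (h1.symm.trans hY) hl

theorem isPiSystem_cyl : IsPiSystem (Set.range fun σ : List Bool => Cyl {σ}) := by
  rintro _ ⟨σ, rfl⟩ _ ⟨τ, rfl⟩ h
  rcases le_total τ.length σ.length with hl | hl
  · exact ⟨σ, (Set.inter_eq_left.2 (cyl_singleton_subset h hl)).symm⟩
  · exact ⟨τ, (Set.inter_eq_right.2 (cyl_singleton_subset (Set.inter_comm _ _ ▸ h) hl)).symm⟩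

theorem generateFrom_cyl : (inferInstance : MeasurableSpace (ℕ → Bool)) =
    MeasurableSpace.generateFrom (Set.range fun σ : List Bool => Cyl {σ}) := by
  apply le_antisymm
  · refine iSup_le fun i => ?_
    rintro _ ⟨s, -, rfl⟩
    have : (fun X : ℕ → Bool => X i) ⁻¹' s =
        ⋃ σ ∈ {σ : List Bool | ∃ b ∈ s, σ[i]? = some b}, Cyl {σ} := by
      ext X
      simp only [Set.mem_preimage, Set.mem_iUnion, Set.mem_ofPred_eq, mem_cyl_singleton, exists_prop]
      constructor
      · intro h
        exact ⟨initSeg X (i + 1), ⟨X i, h, getElem?_initSeg X (by simp)⟩, by simp⟩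
      · rintro ⟨σ, ⟨b, hb, h⟩, hσ⟩
        rw [hσ, getElem?_initSeg_eq_some] at h
        rwa [h.2]
    rw [this]
    exact MeasurableSet.biUnion (Set.to_countable _) fun σ _ =>
      MeasurableSpace.measurableSet_generateFrom ⟨σ, rfl⟩
  · refine MeasurableSpace.generateFrom_le ?_
    rintro _ ⟨σ, rfl⟩
    exact measurableSet_cyl _

theorem ext_of_cyl {μ ν : Measure (ℕ → Bool)} [IsFiniteMeasure μ]
    (h : ∀ σ : List Bool, μ (Cyl {σ}) = ν (Cyl {σ})) : μ = ν := by
  refine ext_of_generate_finite _ generateFrom_cyl isPiSystem_cyl ?_ ?_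
  · rintro _ ⟨σ, rfl⟩
    exact h σ
  · have : Cyl {[]} = Set.univ := by
      ext X
      simp [mem_cyl_singleton, initSeg]
    rw [← this, h]

/-- The binary expansion map whose pushforward defines `mu`. -/
noncomputable def binaryExpansion (x : ℝ) (n : ℕ) : Bool := decide (⌊x * 2 ^ (n + 1)⌋₊ % 2 = 1)

theorem measurable_binaryExpansion : Measurable binaryExpansion := by
  refine measurable_pi_lambda _ fun n => ?_
  have h : Measurable fun x : ℝ => ⌊x * 2 ^ (n + 1)⌋₊ :=
    Nat.measurable_floor.comp (by fun_prop)
  exact (measurable_from_top (f := fun k : ℕ => decide (k % 2 = 1))).comp h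

theorem mu_eq_map : mu = Measure.map binaryExpansion (volume.restrict (Set.Ico (0 : ℝ) 1)) := rfl

instance : IsProbabilityMeasure mu := by
  have : IsProbabilityMeasure (volume.restrict (Set.Ico (0 : ℝ) 1)) := ⟨by simp⟩
  exact Measure.isProbabilityMeasure_map measurable_binaryExpansion.aemeasurable

/-- The natural number with binary digits `σ`, most significant digit first. -/
def binaryValue (σ : List Bool) : ℕ := σ.foldl (fun k b => 2 * k + b.toNat) 0

theorem binaryValue_append (σ : List Bool) (b : Bool) :
    binaryValue (σ ++ [b]) = 2 * binaryValue σ + b.toNat := by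
  simp [binaryValue]

theorem binaryValue_lt (σ : List Bool) : binaryValue σ < 2 ^ σ.length := by
  induction σ using List.reverseRecOn with
  | nil => simp [binaryValue]
  | append_singleton σ b ih =>
    rw [binaryValue_append, List.length_append, List.length_singleton, pow_succ]
    have := b.toNat_lt
    omega

theorem floor_two_mul_div (x : ℝ) (n : ℕ) : ⌊x * 2 ^ (n + 1)⌋₊ / 2 = ⌊x * 2 ^ n⌋₊ := by
  rw [← Nat.floor_div_natCast]
  congr 1
  rw [pow_succ]
  push_cast
  ring

theorem binaryExpansion_mem_cyl {x : ℝ} (hx : x ∈ Set.Ico (0 : ℝ) 1) (σ : List Bool) :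
    binaryExpansion x ∈ Cyl {σ} ↔ ⌊x * 2 ^ σ.length⌋₊ = binaryValue σ := by
  rw [mem_cyl_singleton]
  induction σ using List.reverseRecOn with
  | nil =>
    simpa [binaryValue, initSeg] using hx.2
  | append_singleton σ b ih =>
    rw [binaryValue_append, List.length_append, List.length_singleton, initSeg_succ]
    have h1 : σ ++ [b] = initSeg (binaryExpansion x) σ.length ++ [binaryExpansion x σ.length] ↔
        σ = initSeg (binaryExpansion x) σ.length ∧ b = binaryExpansion x σ.length := by
      constructor
      · intro h
        simpa using List.append_inj h (by simp)
      · rintro ⟨h, h'⟩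
        rw [← h, ← h']
    rw [h1, ih, ← floor_two_mul_div]
    simp only [binaryExpansion]
    generalize ⌊x * 2 ^ (σ.length + 1)⌋₊ = k
    generalize binaryValue σ = v
    cases b <;> simp <;> omega

theorem mu_cyl_singleton (σ : List Bool) : mu (Cyl {σ}) = 2⁻¹ ^ σ.length := by
  rw [mu_eq_map, Measure.map_apply measurable_binaryExpansion (measurableSet_cyl _),
    Measure.restrict_apply (measurable_binaryExpansion (measurableSet_cyl _))]
  have hv : (binaryValue σ : ℝ) + 1 ≤ 2 ^ σ.length := by exact_mod_cast binaryValue_lt σ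
  have hp : (0 : ℝ) < 2 ^ σ.length := by positivity
  have : binaryExpansion ⁻¹' Cyl {σ} ∩ Set.Ico 0 1 =
      Set.Ico ((binaryValue σ : ℝ) / 2 ^ σ.length) ((binaryValue σ + 1) / 2 ^ σ.length) := by
    ext x
    constructor
    · rintro ⟨h1, h2⟩
      rw [Set.mem_preimage, binaryExpansion_mem_cyl h2, Nat.floor_eq_iff (by
        have := h2.1
        positivity)] at h1
      rwa [Set.mem_Ico, div_le_iff₀ hp, lt_div_iff₀ hp]
    · intro h
      have hx : x ∈ Set.Ico (0 : ℝ) 1 :=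
        ⟨le_trans (by positivity) h.1, h.2.trans_le ((div_le_one hp).2 hv)⟩
      refine ⟨?_, hx⟩
      rw [Set.mem_preimage, binaryExpansion_mem_cyl hx, Nat.floor_eq_iff (by
        have := hx.1
        positivity)]
      rwa [Set.mem_Ico, div_le_iff₀ hp, lt_div_iff₀ hp] at h
  rw [this, Real.volume_Ico, ← sub_div, add_sub_cancel_left, one_div, ← inv_pow,
    ENNReal.ofReal_pow (by positivity), ENNReal.ofReal_inv_of_pos (by simp)]
  simp

/-- The fair coin. -/
noncomputable def coin : Measure Bool := (2⁻¹ : ℝ≥0∞) • Measure.count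

theorem coin_singleton (b : Bool) : coin {b} = 2⁻¹ := by simp [coin]

instance : IsProbabilityMeasure coin := ⟨by
  rw [coin, Measure.smul_apply, Measure.count_univ]
  simp [ENNReal.inv_mul_cancel]⟩

theorem mu_eq_infinitePi : mu = Measure.infinitePi fun _ : ℕ => coin := by
  refine ext_of_cyl fun σ => ?_
  have : Cyl {σ} = Set.pi (Finset.range σ.length) fun i => {σ.getD i false} := by
    ext X
    simp only [mem_cyl_singleton, eq_initSeg_iff, Set.mem_pi, Finset.mem_coe, Finset.mem_range,
      Set.mem_singleton_iff]
    refine forall₂_congr fun i hi => ?_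
    simp [hi, eq_comm]
  rw [mu_cyl_singleton, this, Measure.infinitePi_pi _ fun _ _ => measurableSet_singleton _]
  simp [coin_singleton]

theorem mu_forall_eq_false (S : Finset ℕ) : mu {X | ∀ i ∈ S, X i = false} = 2⁻¹ ^ S.card := by
  have : {X : ℕ → Bool | ∀ i ∈ S, X i = false} = Set.pi S fun _ => {false} := by
    ext X
    simp
  rw [mu_eq_infinitePi, this, Measure.infinitePi_pi _ fun _ _ => measurableSet_singleton _]
  simp [coin_singleton]

/-- The weight of a set of strings. -/
noncomputable def weight (W : Set (List Bool)) : ℝ≥0∞ := ∑' σ : W, 2⁻¹ ^ σ.1.length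

theorem mu_cyl_le_weight (W : Set (List Bool)) : mu (Cyl W) ≤ weight W := by
  rw [cyl_eq_biUnion]
  refine (measure_biUnion_le _ (Set.to_countable _) _).trans_eq ?_
  simp [weight, mu_cyl_singleton]

/-- No member of the set is a proper initial segment of another one. -/
def PrefixFree (W : Set (List Bool)) : Prop := ∀ σ ∈ W, ∀ τ ∈ W, σ <+: τ → σ = τ

theorem PrefixFree.eq_of_initSeg {W : Set (List Bool)} (hW : PrefixFree W) {X : ℕ → Bool}
    {m n : ℕ} (hm : initSeg X m ∈ W) (hn : initSeg X n ∈ W) : m = n := by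
  wlog h : m ≤ n generalizing m n
  · exact (this hn hm (by omega)).symm
  have := hW _ hm _ hn ⟨_, by rw [← take_initSeg X h, List.take_append_drop]⟩
  simpa using congrArg List.length this

theorem PrefixFree.mu_cyl {W : Set (List Bool)} (hW : PrefixFree W) : mu (Cyl W) = weight W := by
  rw [cyl_eq_biUnion, measure_biUnion (Set.to_countable _) _ fun _ _ => measurableSet_cyl _]
  · simp [weight, mu_cyl_singleton]
  · intro σ hσ τ hτ hne
    rw [Function.onFun, Set.disjoint_left]
    intro X h1 h2
    rw [mem_cyl_singleton] at h1 h2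
    rw [h1] at hσ
    rw [h2] at hτ
    exact hne (h1.trans ((congrArg _ (hW.eq_of_initSeg hσ hτ)).trans h2.symm))

end Measure

section PrefixFree

open scoped ENNReal

variable {α : Type*} [Primcodable α] {A B : Set ℕ}

theorem SigmaOne.exists_prefixFree {W : α → Set (List Bool)}
    (h : SigmaOne A fun x : α × List Bool => x.2 ∈ W x.1) :
    ∃ M : α → List Bool → List ℕ → Prop,
      PrimrecPred (fun x : α × List Bool × List ℕ => M x.1 x.2.1 x.2.2) ∧
      ∀ a, PrefixFree {σ | M a σ (initSeg (chi A) σ.length)} ∧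
        Cyl {σ | M a σ (initSeg (chi A) σ.length)} = Cyl (W a) := by
  classical
  obtain ⟨r, hr, hW⟩ := h
  let D : α → List Bool → List ℕ → Prop := fun a σ τ =>
    ∃ i, i < σ.length + 1 ∧ ∃ j, j < σ.length + 1 ∧ r (a, σ.take i) (τ.take j)
  have hD : PrimrecPred fun x : α × List Bool × List ℕ => D x.1 x.2.1 x.2.2 := by fun_prop
  refine ⟨fun a σ τ => D a σ τ ∧ ∀ i, i < σ.length → ¬ D a (σ.take i) (τ.take i), ?_, fun a => ?_⟩
  · refine PrimrecPred.and hD (primrecPred_forall_lt (PrimrecPred.not ?_) (by fun_prop))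
    exact hD.comp (f := fun x : (α × List Bool × List ℕ) × ℕ =>
      (x.1.1, x.1.2.1.take x.2, x.1.2.2.take x.2)) (by fun_prop)
  have hM : ∀ σ : List Bool, (D a σ (initSeg (chi A) σ.length) ∧ ∀ i, i < σ.length →
      ¬ D a (σ.take i) ((initSeg (chi A) σ.length).take i)) ↔
      (D a σ (initSeg (chi A) σ.length) ∧ ∀ i, i < σ.length →
      ¬ D a (σ.take i) (initSeg (chi A) i)) := fun σ =>
    and_congr_right fun _ => forall₂_congr fun i hi => by rw [take_initSeg _ hi.le]
  constructor
  · intro σ hσ τ hτ hστ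
    simp only [Set.mem_ofPred_eq, hM] at hσ hτ
    refine hστ.eq_of_length_le (not_lt.1 fun hl => hτ.2 _ hl ?_)
    rw [← List.prefix_iff_eq_take.1 hστ]
    exact hσ.1
  · ext X
    simp only [mem_cyl, Set.mem_ofPred_eq, hM]
    constructor
    · rintro ⟨n, ⟨i, hi, j, hj, h⟩, -⟩
      simp only [length_initSeg] at hi hj h
      rw [take_initSeg _ (by omega), take_initSeg _ (by omega)] at h
      exact ⟨i, (hW (a, initSeg X i)).2 ⟨j, h⟩⟩
    · rintro ⟨i, hi⟩
      obtain ⟨j, hj⟩ := (hW (a, initSeg X i)).1 hi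
      have hex : ∃ n, D a (initSeg X n) (initSeg (chi A) n) := by
        refine ⟨max i j, i, by simp, j, by simp, ?_⟩
        rwa [take_initSeg _ (le_max_left _ _), take_initSeg _ (le_max_right _ _)]
      refine ⟨Nat.find hex, by simpa using Nat.find_spec hex, fun i hi => ?_⟩
      rw [length_initSeg] at hi
      rw [take_initSeg _ hi.le]
      exact Nat.find_min hex hi

theorem SigmaOne.initSeg_pred {M : α → List Bool → List ℕ → Prop}
    (hM : PrimrecPred fun x : α × List Bool × List ℕ => M x.1 x.2.1 x.2.2) :
    SigmaOne A fun x : α × List Bool => M x.1 x.2 (initSeg (chi A) x.2.length) := by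
  have : SigmaOne A fun x : α × List Bool =>
      ∃ τ : List ℕ, τ = initSeg (chi A) x.2.length ∧ M x.1 x.2 τ := by
    refine SigmaOne.exists (SigmaOne.and (by fun_prop) (PrimrecPred.sigmaOne ?_))
    exact hM.comp (f := fun x : (α × List Bool) × List ℕ => (x.1.1, x.1.2, x.2)) (by fun_prop)
  exact this.of_iff fun x => by simp

theorem exists_prefixFree_seq {W : α → Set (List Bool)}
    (h : SigmaOne A fun x : α × List Bool => x.2 ∈ W x.1) :
    ∃ V : α → Set (List Bool), SigmaOne A (fun x : α × List Bool => x.2 ∈ V x.1) ∧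
      ∀ a, PrefixFree (V a) ∧ Cyl (V a) = Cyl (W a) := by
  obtain ⟨M, hM, h⟩ := h.exists_prefixFree
  exact ⟨fun a => {σ | M a σ (initSeg (chi A) σ.length)}, SigmaOne.initSeg_pred hM, h⟩

end PrefixFree

section Strings

open scoped ENNReal

variable {α β : Type*} [Primcodable α] [Primcodable β] {A B : Set ℕ}

/-- The list of all binary strings of a given length. -/
def strings : ℕ → List (List Bool)
  | 0 => [[]]
  | n + 1 => (strings n).flatMap fun σ => [σ ++ [false], σ ++ [true]]

theorem primrec_strings : Primrec strings := by
  have : Primrec fun n : ℕ => (Nat.rec [[]]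
      (fun _ l => l.flatMap fun σ => [σ ++ [false], σ ++ [true]]) n : List (List Bool)) :=
    Primrec.nat_rec₁ _ (show Primrec fun x : ℕ × List (List Bool) =>
      x.2.flatMap fun σ => [σ ++ [false], σ ++ [true]] by fun_prop)
  refine this.of_eq fun n => ?_
  induction n with
  | zero => rfl
  | succ n ih => simp only [ih, strings]

attribute [fun_prop] primrec_strings

theorem mem_strings {n : ℕ} {σ : List Bool} : σ ∈ strings n ↔ σ.length = n := by
  induction n generalizing σ with
  | zero => simp [strings]
  | succ n ih =>
    simp only [strings, List.mem_flatMap, ih, List.mem_cons, List.not_mem_nil, or_false]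
    constructor
    · rintro ⟨τ, rfl, rfl | rfl⟩ <;> simp
    · intro h
      have hne : σ ≠ [] := by
        rintro rfl
        simp at h
      refine ⟨σ.dropLast, by simp [h], ?_⟩
      have := List.dropLast_append_getLast hne
      cases hb : σ.getLast hne <;> rw [hb] at this <;> simp [this]

theorem exists_initSeg_eq (σ : List Bool) : ∃ X : ℕ → Bool, initSeg X σ.length = σ := by
  refine ⟨fun i => σ.getD i false, Eq.symm ((eq_initSeg_iff _).2 fun i hi => ?_)⟩
  simp [hi]

/-- Compactness of Cantor space. -/
theorem cyl_eq_univ_iff {W : Set (List Bool)} :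
    Cyl W = Set.univ ↔ ∃ s, ∀ ρ, ρ ∈ strings s → ∃ i, i < s + 1 ∧ ρ.take i ∈ W := by
  simp only [mem_strings]
  constructor
  · intro h
    by_contra hc
    push Not at hc
    let K : ℕ → Set (ℕ → Bool) := fun s => ⋂ i ∈ Finset.range (s + 1), (Cyl {σ | σ ∈ W ∧ σ.length = i})ᶜ
    have hK : ∀ s X, X ∈ K s ↔ ∀ i, i < s + 1 → initSeg X i ∉ W := by
      intro s X
      simp only [K, Set.mem_iInter, Finset.mem_range, Set.mem_compl_iff, mem_cyl, Set.mem_ofPred_eq,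
        not_exists, not_and, length_initSeg]
      exact ⟨fun h i hi hW => h i hi i hW rfl, fun h i hi j hj hji => h i hi (hji ▸ hj)⟩
    have hcl : ∀ s, IsClosed (K s) := fun s =>
      isClosed_biInter fun i _ => (isOpen_cyl _).isClosed_compl
    obtain ⟨X, hX⟩ := IsCompact.nonempty_iInter_of_sequence_nonempty_isCompact_isClosed K
      (fun s X hX => (hK _ _).2 fun i hi => (hK _ _).1 hX i (by omega)) (fun s => by
        obtain ⟨ρ, h1, h2⟩ := hc s
        obtain ⟨X, hX⟩ := exists_initSeg_eq ρ
        refine ⟨X, (hK _ _).2 fun i hi => ?_⟩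
        rw [← take_initSeg X (show i ≤ ρ.length by omega), hX]
        exact h2 i hi) (hcl 0).isCompact hcl
    have hXW : X ∈ Cyl W := h ▸ trivial
    obtain ⟨n, hn⟩ := mem_cyl.1 hXW
    exact (hK _ _).1 (Set.mem_iInter.1 hX n) n (by simp) hn
  · rintro ⟨s, hs⟩
    refine Set.eq_univ_of_forall fun X => mem_cyl.2 ?_
    obtain ⟨i, hi, h⟩ := hs (initSeg X s) (by simp)
    rw [take_initSeg X (by omega)] at h
    exact ⟨i, h⟩

theorem SigmaOne.cyl_eq_univ {W : α → Set (List Bool)}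
    (h : SigmaOne A fun x : α × List Bool => x.2 ∈ W x.1) :
    SigmaOne A fun a => Cyl (W a) = Set.univ := by
  have : SigmaOne A fun a => ∃ s : ℕ, ∀ ρ, ρ ∈ strings s → ∃ i, i < s + 1 ∧ ρ.take i ∈ W a := by
    refine SigmaOne.exists (SigmaOne.forall_mem (SigmaOne.exists (SigmaOne.and (by fun_prop) ?_))
      (by fun_prop))
    exact h.comp (f := fun x : ((α × ℕ) × List Bool) × ℕ => (x.1.1.1, x.1.2.take x.2)) (by fun_prop)
  exact this.of_iff fun a => cyl_eq_univ_iff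

theorem SigmaOne.cyl_singleton_subset {W : α → Set (List Bool)} {τ : α → List Bool}
    (h : SigmaOne A fun x : α × List Bool => x.2 ∈ W x.1) (hτ : Primrec τ) :
    SigmaOne A fun a => Cyl {τ a} ⊆ Cyl (W a) := by
  have h' : SigmaOne A fun x : α × List Bool =>
      x.2 ∈ {σ | σ ∈ W x.1 ∨ (σ.length = (τ x.1).length ∧ ¬ σ = τ x.1)} :=
    SigmaOne.or h (PrimrecPred.sigmaOne (by fun_prop))
  refine (SigmaOne.cyl_eq_univ (W := fun a =>
    {σ | σ ∈ W a ∨ (σ.length = (τ a).length ∧ ¬ σ = τ a)}) h').of_iff fun a => ?_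
  rw [Set.eq_univ_iff_forall]
  refine forall_congr' fun X => ?_
  rw [mem_cyl_singleton]
  simp only [mem_cyl, Set.mem_ofPred_eq, length_initSeg]
  constructor
  · intro h
    by_cases hX : τ a = initSeg X (τ a).length
    · obtain ⟨n, hn⟩ := h hX
      exact ⟨n, .inl hn⟩
    · exact ⟨_, .inr ⟨rfl, fun h => hX h.symm⟩⟩
  · rintro ⟨n, h | ⟨rfl, h⟩⟩ hX
    · exact ⟨n, h⟩
    · exact absurd hX.symm h

end Strings

section Kucera

open scoped ENNReal

variable {A B : Set ℕ}

theorem tail_drop (X : ℕ → Bool) (m n : ℕ) :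
    (initSeg X n).drop m = initSeg (fun i => X (m + i)) (n - m) := by
  rcases le_total m n with h | h
  · obtain ⟨k, rfl⟩ := Nat.exists_eq_add_of_le h
    rw [initSeg_add, List.drop_append_of_le_length (by simp)]
    simp
  · rw [List.drop_eq_nil_of_le (by simpa), Nat.sub_eq_zero_of_le h]
    rfl

theorem tsum_le_of_surjective {ι κ : Type*} {f : ι → κ} (hf : Function.Surjective f)
    {u : κ → ℝ≥0∞} {v : ι → ℝ≥0∞} (h : ∀ i, u (f i) ≤ v i) : ∑' k, u k ≤ ∑' i, v i :=
  (ENNReal.tsum_le_tsum_comp_of_surjective hf u).trans (ENNReal.tsum_le_tsum h)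

/-- Concatenations of `k` members of a set of strings. -/
def concats (M : Set (List Bool)) (k : ℕ) : Set (List Bool) :=
  {σ | ∃ L : List (List Bool), L.length = k ∧ (∀ τ, τ ∈ L → τ ∈ M) ∧ σ = L.flatten}

theorem weight_concats_le (M : Set (List Bool)) (k : ℕ) : weight (concats M k) ≤ weight M ^ k := by
  induction k with
  | zero =>
    have : concats M 0 = {[]} := by
      ext σ
      simp only [concats, Set.mem_ofPred_eq, Set.mem_singleton_iff, List.length_eq_zero_iff]
      constructor
      · rintro ⟨_, rfl, -, rfl⟩
        rfl
      · rintro rfl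
        exact ⟨[], rfl, by simp, rfl⟩
    rw [this]
    simp [weight]
  | succ k ih =>
    rw [pow_succ']
    refine le_trans ?_ (mul_le_mul_right ih _)
    have : weight M * weight (concats M k) =
        ∑' x : M × concats M k, 2⁻¹ ^ x.1.1.length * 2⁻¹ ^ x.2.1.length := by
      refine Eq.trans ?_ (ENNReal.tsum_prod (f := fun (τ : M) (σ : concats M k) =>
        (2⁻¹ : ℝ≥0∞) ^ τ.1.length * 2⁻¹ ^ σ.1.length)).symm
      simp only [weight, ENNReal.tsum_mul_left, ENNReal.tsum_mul_right]
    rw [this]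
    have hmem : ∀ x : M × concats M k, x.1.1 ++ x.2.1 ∈ concats M (k + 1) := by
      rintro ⟨⟨τ, hτ⟩, ⟨_, L, rfl, hL, rfl⟩⟩
      exact ⟨τ :: L, by simp, by simpa using ⟨hτ, hL⟩, by simp⟩
    refine tsum_le_of_surjective (f := fun x => ⟨_, hmem x⟩) ?_ ?_
    · rintro ⟨_, L, hl, hL, rfl⟩
      cases L with
      | nil => simp at hl
      | cons τ L =>
        exact ⟨⟨⟨τ, hL τ (by simp)⟩, ⟨_, L, by simpa using hl, fun σ h => hL σ (by simp [h]), rfl⟩⟩,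
          by simp⟩
    · intro x
      simp [pow_add]

theorem mem_cyl_concats {M : Set (List Bool)} {X : ℕ → Bool}
    (h : ∀ m, (fun i => X (m + i)) ∈ Cyl M) (k : ℕ) : X ∈ Cyl (concats M k) := by
  induction k generalizing X with
  | zero => exact mem_cyl.2 ⟨0, [], rfl, by simp, rfl⟩
  | succ k ih =>
    obtain ⟨n, hn⟩ := mem_cyl.1 (h 0)
    obtain ⟨m, L, h1, h2, h3⟩ := mem_cyl.1 (ih (X := fun i => X (n + i))
      fun m => by simpa [add_assoc] using h (n + m))
    refine mem_cyl.2 ⟨n + m, initSeg X n :: L, by simp [h1], ?_, ?_⟩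
    · simpa using ⟨by simpa using hn, h2⟩
    · rw [initSeg_add, h3, List.flatten_cons]

theorem cyl_concats_subset (M : Set (List Bool)) {k l : ℕ} (hkl : k ≤ l) :
    Cyl (concats M l) ⊆ Cyl (concats M k) := by
  intro X hX
  obtain ⟨n, L, h1, h2, h3⟩ := mem_cyl.1 hX
  refine mem_cyl.2 ⟨(L.take k).flatten.length, L.take k, by simp; omega,
    fun τ hτ => h2 τ (List.mem_of_mem_take hτ), ?_⟩
  have h4 : L.flatten = (L.take k).flatten ++ (L.drop k).flatten := by
    rw [← List.flatten_append, List.take_append_drop]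
  have h5 : (L.take k).flatten.length ≤ n := by
    have := congrArg List.length (h3.trans h4)
    simp only [length_initSeg, List.length_append] at this
    omega
  rw [← take_initSeg X h5, h3, h4, List.take_left']
  rfl

/-- A sequence all of whose tails lie in an open set that is c.e. in `B` and not of full measure
is not random relative to `B`. -/
theorem not_mlRandom_of_forall_tail {Y : Set (List Bool)} (hY : SigmaOne B (· ∈ Y))
    (hlt : mu (Cyl Y) < 1) {X : ℕ → Bool} (hX : ∀ m, (fun i => X (m + i)) ∈ Cyl Y) :
    ¬ MLRandom B X := by
  obtain ⟨M, hM, hMY⟩ := exists_prefixFree_seq (α := Unit) (W := fun _ => Y)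
    (hY.comp (f := fun x : Unit × List Bool => x.2) (by fun_prop))
  obtain ⟨hpf, hcyl⟩ := hMY ()
  rw [← hcyl] at hX hlt
  rw [hpf.mu_cyl] at hlt
  obtain ⟨c, hc⟩ := ((ENNReal.tendsto_pow_atTop_nhds_zero_of_lt_one hlt).eventually_le_const
    (show (0 : ℝ≥0∞) < 2⁻¹ by simp)).exists
  intro hr
  refine hr (fun n => Cyl (concats (M ()) (c * n))) ⟨_, ceSeqIn_iff.2 ?_, fun _ => rfl, fun n =>
    cyl_concats_subset _ (by gcongr; simp), fun n => ?_⟩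
    (Set.mem_iInter.2 fun n => mem_cyl_concats hX _)
  · have : SigmaOne B (· ∈ M ()) :=
      hM.comp (f := fun σ : List Bool => ((), σ)) (by fun_prop)
    show SigmaOne B fun x : ℕ × List Bool => ∃ L : List (List Bool),
      L.length = c * x.1 ∧ (∀ τ, τ ∈ L → τ ∈ M ()) ∧ x.2 = L.flatten
    refine SigmaOne.exists (SigmaOne.and (by fun_prop)
      (SigmaOne.and (SigmaOne.forall_mem ?_ (by fun_prop)) (by fun_prop)))
    exact this.comp (f := fun x : ((ℕ × List Bool) × List (List Bool)) × List Bool => x.2)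
      (by fun_prop)
  · calc mu (Cyl (concats (M ()) (c * n))) ≤ weight (M ()) ^ (c * n) :=
        (mu_cyl_le_weight _).trans (weight_concats_le _ _)
      _ = (weight (M ()) ^ c) ^ n := pow_mul _ _ _
      _ ≤ 2⁻¹ ^ n := by gcongr

end Kucera

section Subclass

open scoped ENNReal

variable {A B : Set ℕ}

/-- Every `Π₁` class relative to `A` has a `Σ₂` subclass relative to `B` of the same measure. -/
def HasSigma2Subclasses (A B : Set ℕ) : Prop :=
  ∀ P : Set (ℕ → Bool), Pi1In A P → ∃ Q : Set (ℕ → Bool), Sigma2In B Q ∧ Q ⊆ P ∧ mu Q = mu P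

/-- The string `0ⁿ1b`. -/
def markString (n : ℕ) (b : Bool) : List Bool := (List.range n).map (fun _ => false) ++ [true, b]

theorem mem_cyl_markString {n : ℕ} {b : Bool} {X : ℕ → Bool} :
    X ∈ Cyl {markString n b} ↔ (∀ i < n, X i = false) ∧ X n = true ∧ X (n + 1) = b := by
  have hl : (markString n b).length = n + 1 + 1 := by simp [markString]
  rw [mem_cyl_singleton, hl, initSeg_succ, initSeg_succ]
  have : markString n b = (List.range n).map (fun _ => false) ++ [true] ++ [b] := by
    simp [markString]
  rw [this]
  constructor
  · intro h
    obtain ⟨h1, h2⟩ := List.append_inj h (by simp)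
    obtain ⟨h3, h4⟩ := List.append_inj h1 (by simp)
    refine ⟨fun i hi => ?_, by simpa using h4.symm, by simpa using h2.symm⟩
    have := congrArg (·[i]?) h3
    simp only [getElem?_initSeg X hi, List.getElem?_map, List.getElem?_range hi,
      Option.map_some, Option.some.injEq] at this
    exact this.symm
  · rintro ⟨h1, h2, h3⟩
    rw [h2, h3]
    congr 2
    exact List.map_congr_left fun i hi => (h1 i (List.mem_range.1 hi)).symm

theorem markString_inj {m n : ℕ} {b c : Bool} {X : ℕ → Bool} (h : X ∈ Cyl {markString m b})
    (h' : X ∈ Cyl {markString n c}) : m = n ∧ b = c := by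
  rw [mem_cyl_markString] at h h'
  rcases lt_trichotomy m n with hlt | rfl | hlt
  · exact absurd (h'.1 m hlt) (by simp [h.2.1])
  · exact ⟨rfl, h.2.2.symm.trans h'.2.2⟩
  · exact absurd (h.1 n hlt) (by simp [h'.2.1])

theorem HasSigma2Subclasses.turingLE (h : HasSigma2Subclasses A B) : TuringLE A (jump B) := by
  let W : Set (List Bool) := {σ | ∃ n, (σ = markString n true ∧ chi A n = 1) ∨
    (σ = markString n false ∧ chi A n = 0)}
  have hW : SigmaOne A (· ∈ W) := by
    show SigmaOne A fun σ => ∃ n, (σ = markString n true ∧ chi A n = 1) ∨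
      (σ = markString n false ∧ chi A n = 0)
    unfold markString
    fun_prop
  have hcyl : ∀ n b X, X ∈ Cyl {markString n b} → (X ∈ Cyl W ↔ (b = true ↔ n ∈ A)) := by
    intro n b X hX
    rw [cyl_eq_biUnion]
    simp only [Set.mem_iUnion, exists_prop]
    constructor
    · rintro ⟨_, ⟨m, ⟨rfl, hm⟩ | ⟨rfl, hm⟩⟩, hX'⟩ <;> obtain ⟨rfl, rfl⟩ := markString_inj hX hX'
      · simpa using chi_eq_one_iff.1 hm
      · simpa using chi_eq_zero_iff.1 hm
    · intro hb
      refine ⟨_, ⟨n, ?_⟩, hX⟩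
      cases b
      · exact .inr ⟨rfl, chi_eq_zero_iff.2 (by simpa using hb)⟩
      · exact .inl ⟨rfl, chi_eq_one_iff.2 (by simpa using hb)⟩
  obtain ⟨Q, ⟨Y, hY, rfl⟩, hQP, hmu⟩ := h _ ⟨W, ceIn_iff.2 hW, rfl⟩
  rw [ceSeqIn_iff] at hY
  have key : ∀ n b, ¬ (b = true ↔ n ∈ A) ↔ ∃ k, ¬ Cyl {markString n b} ⊆ Cyl (Y k) := by
    intro n b
    constructor
    · intro hb
      by_contra hc
      push Not at hc
      have h1 : Cyl {markString n b} ⊆ (Cyl W)ᶜ \ ⋃ k, (Cyl (Y k))ᶜ := by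
        intro X hX
        refine ⟨fun hXW => hb ((hcyl n b X hX).1 hXW), ?_⟩
        simp only [Set.mem_iUnion, not_exists, Set.mem_compl_iff, not_not]
        exact fun k => hc k hX
      have h2 : mu ((Cyl W)ᶜ \ ⋃ k, (Cyl (Y k))ᶜ) = 0 := by
        rw [measure_sdiff hQP (MeasurableSet.iUnion fun k =>
          (measurableSet_cyl _).compl).nullMeasurableSet (measure_ne_top _ _), hmu, tsub_self]
      have h3 := measure_mono_null h1 h2
      rw [mu_cyl_singleton] at h3
      simp at h3
    · rintro ⟨k, hk⟩ hb
      refine hk fun X hX => by_contra fun hXk => ?_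
      exact hQP (Set.mem_iUnion.2 ⟨k, hXk⟩) ((hcyl n b X hX).2 hb)
  have hq : ∀ b, SigmaOne B fun x : ℕ × ℕ => Cyl {markString x.1 b} ⊆ Cyl (Y x.2) := by
    intro b
    refine SigmaOne.cyl_singleton_subset (W := fun x : ℕ × ℕ => Y x.2)
      (hY.comp (f := fun x : (ℕ × ℕ) × List Bool => (x.1.2, x.2)) (by fun_prop)) ?_
    unfold markString
    fun_prop
  exact turingLE_jump_of_exists_not (hq false) (hq true) (fun n => by simpa using key n false)
    fun n => by simpa using key n true

theorem weight_drop_le (V : Set (List Bool)) (m : ℕ) :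
    weight (List.drop m '' V) ≤ 2 ^ m * weight V := by
  unfold weight
  rw [← ENNReal.tsum_mul_left]
  refine tsum_le_of_surjective (f := fun τ : V => (⟨_, _, τ.2, rfl⟩ : List.drop m '' V)) ?_ ?_
  · rintro ⟨_, τ, hτ, rfl⟩
    exact ⟨⟨τ, hτ⟩, rfl⟩
  · rintro ⟨τ, hτ⟩
    simp only [List.length_drop]
    have h2 : (2 : ℝ≥0∞) ^ m * 2⁻¹ ^ m = 1 := by
      rw [← mul_pow, ENNReal.mul_inv_cancel (by simp) (by simp), one_pow]
    calc (2⁻¹ : ℝ≥0∞) ^ (τ.length - m) = 2 ^ m * (2⁻¹ ^ m * 2⁻¹ ^ (τ.length - m)) := by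
          rw [← mul_assoc, h2, one_mul]
      _ ≤ 2 ^ m * 2⁻¹ ^ τ.length := by
        rw [← pow_add]
        gcongr _ * ?_
        exact pow_le_pow_right_of_le_one' (by simp [ENNReal.inv_le_one]) (by omega)

theorem HasSigma2Subclasses.lRle (h : HasSigma2Subclasses A B) : LRle A B := by
  intro X hXB U hU hXU
  obtain ⟨W, hW, hUW, -, hmu⟩ := hU
  obtain ⟨V, hV, hVW⟩ := exists_prefixFree_seq (ceSeqIn_iff.1 hW)
  let S : Set (List Bool) := {σ | ∃ m, ∃ τ, τ ∈ V (2 * m + 2) ∧ σ = τ.drop m}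
  have hS : SigmaOne A (· ∈ S) := by
    refine SigmaOne.exists (SigmaOne.exists (SigmaOne.and ?_ (by fun_prop)))
    exact hV.comp (f := fun x : (List Bool × ℕ) × List Bool => (2 * x.1.2 + 2, x.2)) (by fun_prop)
  have hSmu : mu (Cyl S) ≤ 2⁻¹ := by
    have hS' : Cyl S ⊆ ⋃ m, Cyl (List.drop m '' V (2 * m + 2)) := by
      rintro Y hY
      obtain ⟨n, m, τ, hτ, h⟩ := mem_cyl.1 hY
      exact Set.mem_iUnion.2 ⟨m, mem_cyl.2 ⟨n, τ, hτ, h.symm⟩⟩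
    have hb : ∀ m, mu (Cyl (List.drop m '' V (2 * m + 2))) ≤ 2⁻¹ ^ 2 * 2⁻¹ ^ m := by
      intro m
      refine (mu_cyl_le_weight _).trans ((weight_drop_le _ _).trans ?_)
      rw [← (hVW _).1.mu_cyl, (hVW _).2, ← hUW]
      calc (2 : ℝ≥0∞) ^ m * mu (U (2 * m + 2)) ≤ 2 ^ m * 2⁻¹ ^ (2 * m + 2) := by
            gcongr
            exact hmu _
        _ = (2 ^ m * 2⁻¹ ^ m) * (2⁻¹ ^ 2 * 2⁻¹ ^ m) := by ring
        _ = 2⁻¹ ^ 2 * 2⁻¹ ^ m := by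
          rw [← mul_pow, ENNReal.mul_inv_cancel (by simp) (by simp), one_pow, one_mul]
    refine (measure_mono hS').trans ((measure_iUnion_le _).trans ((ENNReal.tsum_le_tsum hb).trans ?_))
    rw [ENNReal.tsum_mul_left, ENNReal.tsum_geometric, ENNReal.one_sub_inv_two, inv_inv, pow_two,
      mul_assoc, ENNReal.inv_mul_cancel (by simp) (by simp), mul_one]
  have htail : ∀ m, (fun i => X (m + i)) ∈ Cyl S := by
    intro m
    have hX : X ∈ Cyl (V (2 * m + 2)) := by
      rw [(hVW _).2, ← hUW]
      exact Set.mem_iInter.1 hXU _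
    obtain ⟨n, hn⟩ := mem_cyl.1 hX
    exact mem_cyl.2 ⟨n - m, m, _, hn, (tail_drop X m n).symm⟩
  obtain ⟨Q, ⟨Y, hY, rfl⟩, hQP, hQmu⟩ := h _ ⟨S, ceIn_iff.2 hS, rfl⟩
  have hpos : mu (⋃ k, (Cyl (Y k))ᶜ) ≠ 0 := by
    rw [hQmu, Ne, prob_compl_eq_zero_iff (measurableSet_cyl _)]
    intro h1
    rw [h1] at hSmu
    exact absurd hSmu (by simp)
  obtain ⟨k, hk⟩ : ∃ k, mu (Cyl (Y k))ᶜ ≠ 0 := by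
    by_contra hc
    push Not at hc
    exact hpos (measure_iUnion_null hc)
  rw [Ne, prob_compl_eq_zero_iff (measurableSet_cyl _)] at hk
  refine not_mlRandom_of_forall_tail (Y := Y k) ?_ (lt_of_le_of_ne prob_le_one hk) (fun m => ?_) hXB
  · exact (ceSeqIn_iff.1 hY).comp (f := fun σ : List Bool => (k, σ)) (by fun_prop)
  · by_contra hc
    exact hQP (Set.mem_iUnion.2 ⟨k, hc⟩) (htail m)

end Subclass

section Blocks

open scoped ENNReal

variable {α : Type*} [Primcodable α] {A B : Set ℕ} {f : ℕ → ℕ}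

/-- The sequences vanishing on the first `f g` entries of the column `g`. -/
def zeroBlock (f : ℕ → ℕ) (g : ℕ) : Set (ℕ → Bool) := {X | ∀ i < f g, X (Nat.pair g i) = false}

/-- The positions inspected by `zeroBlock f g`. -/
def blockPositions (f : ℕ → ℕ) (g : ℕ) : Finset ℕ := (Finset.range (f g)).image (Nat.pair g)

theorem mu_biInter_zeroBlock (f : ℕ → ℕ) (s : Finset ℕ) :
    mu (⋂ g ∈ s, zeroBlock f g) = ∏ g ∈ s, 2⁻¹ ^ f g := by
  have h1 : ⋂ g ∈ s, zeroBlock f g = {X | ∀ i ∈ s.biUnion (blockPositions f), X i = false} := by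
    ext X
    simp only [Set.mem_iInter, zeroBlock, blockPositions, Set.mem_ofPred_eq, Finset.mem_biUnion,
      Finset.mem_image, Finset.mem_range]
    constructor
    · rintro h _ ⟨g, hg, i, hi, rfl⟩
      exact h g hg i hi
    · exact fun h g hg i hi => h _ ⟨g, hg, i, hi, rfl⟩
  rw [h1, mu_forall_eq_false, Finset.card_biUnion, ← Finset.prod_pow_eq_pow_sum]
  · refine Finset.prod_congr rfl fun g _ => ?_
    rw [blockPositions, Finset.card_image_of_injective _ fun i j h => (Nat.pair_eq_pair.1 h).2,
      Finset.card_range]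
  · intro g _ h _ hgh
    simp only [Function.onFun, Finset.disjoint_left, blockPositions, Finset.mem_image]
    rintro _ ⟨i, -, rfl⟩ ⟨j, -, hj⟩
    exact hgh (Nat.pair_eq_pair.1 hj).1.symm

theorem mu_zeroBlock (f : ℕ → ℕ) (g : ℕ) : mu (zeroBlock f g) = 2⁻¹ ^ f g := by
  simpa using mu_biInter_zeroBlock f {g}

theorem zeroBlock_eq_compl_cyl (f : ℕ → ℕ) (g : ℕ) :
    zeroBlock f g = (Cyl {σ | ∃ i, i < f g ∧ σ[Nat.pair g i]? = some true})ᶜ := by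
  ext X
  simp only [zeroBlock, Set.mem_ofPred_eq, Set.mem_compl_iff, mem_cyl, not_exists, not_and,
    getElem?_initSeg_eq_some]
  exact ⟨fun h _ i hi _ => by simp [h i hi], fun h i hi =>
    by simpa using h (Nat.pair g i + 1) i hi (Nat.lt_succ_self _)⟩

theorem measurableSet_zeroBlock (f : ℕ → ℕ) (g : ℕ) : MeasurableSet (zeroBlock f g) := by
  rw [zeroBlock_eq_compl_cyl]
  exact (measurableSet_cyl _).compl

/-- The sequences lying in at least `k` of the blocks indexed by `G`. -/
def manyBlocks (f : ℕ → ℕ) (G : Set ℕ) (k : ℕ) : Set (List Bool) :=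
  {σ | ∃ L : List ℕ, L.length = k ∧ (∀ j, j < L.length → ∀ i, i < j → ¬ L[i]? = L[j]?) ∧
    ∀ g, g ∈ L → g ∈ G ∧ ∀ i, i < f g → σ[Nat.pair g i]? = some false}

theorem mem_cyl_manyBlocks {G : Set ℕ} {k : ℕ} {X : ℕ → Bool} : X ∈ Cyl (manyBlocks f G k) ↔
    ∃ s : Finset ℕ, s.card = k ∧ ∀ g ∈ s, g ∈ G ∧ X ∈ zeroBlock f g := by
  have hnd : ∀ L : List ℕ, L.Nodup ↔ ∀ j, j < L.length → ∀ i, i < j → ¬ L[i]? = L[j]? := fun L => by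
    rw [List.nodup_iff_getElem?_ne_getElem?]
    exact ⟨fun h j hj i hi => h i j hi hj, fun h i j hi hj => h j hj i hi⟩
  simp only [mem_cyl, manyBlocks, ← hnd, Set.mem_ofPred_eq, zeroBlock, getElem?_initSeg_eq_some]
  constructor
  · rintro ⟨n, L, h1, h2, h3⟩
    exact ⟨L.toFinset, by rw [List.toFinset_card_of_nodup h2, h1], fun g hg =>
      ⟨(h3 g (by simpa using hg)).1, fun i hi => ((h3 g (by simpa using hg)).2 i hi).2⟩⟩
  · rintro ⟨s, h1, h2⟩
    refine ⟨(s.biUnion (blockPositions f)).sup id + 1, s.toList, by simpa, s.nodup_toList,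
      fun g hg => ?_⟩
    rw [Finset.mem_toList] at hg
    refine ⟨(h2 g hg).1, fun i hi => ⟨Nat.lt_succ_of_le ?_, (h2 g hg).2 i hi⟩⟩
    refine Finset.le_sup (f := id) (Finset.mem_biUnion.2 ⟨g, hg, ?_⟩)
    exact Finset.mem_image_of_mem _ (Finset.mem_range.2 hi)

/-- Markov's inequality for the number of blocks containing a sequence. -/
theorem mul_mu_manyBlocks_le (f : ℕ → ℕ) (G : Set ℕ) (k : ℕ) :
    k * mu (Cyl (manyBlocks f G k)) ≤ ∑' g : G, 2⁻¹ ^ f g := by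
  classical
  have hm : ∀ g : G, Measurable ((zeroBlock f g).indicator fun _ => (1 : ℝ≥0∞)) := fun g =>
    measurable_const.indicator (measurableSet_zeroBlock f g)
  calc k * mu (Cyl (manyBlocks f G k))
      ≤ k * mu {X | (k : ℝ≥0∞) ≤ ∑' g : G, (zeroBlock f g).indicator (fun _ => 1) X} := by
        gcongr
        intro X hX
        obtain ⟨s, rfl, hs⟩ := mem_cyl_manyBlocks.1 hX
        rw [Set.mem_ofPred_eq]
        refine le_trans ?_ (ENNReal.sum_le_tsum (s.subtype (· ∈ G)))
        rw [Finset.sum_subtype_of_mem (fun g => (zeroBlock f g).indicator (fun _ => (1 : ℝ≥0∞)) X)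
          fun g hg => (hs g hg).1, Finset.sum_congr rfl fun g hg =>
          Set.indicator_of_mem (hs g hg).2 (fun _ => (1 : ℝ≥0∞))]
        simp
    _ ≤ ∫⁻ X, ∑' g : G, (zeroBlock f g).indicator (fun _ => 1) X ∂mu :=
        mul_meas_ge_le_lintegral (Measurable.tsum hm) _
    _ = ∑' g : G, 2⁻¹ ^ f g := by
        rw [lintegral_tsum fun g => (hm g).aemeasurable]
        refine tsum_congr fun g => ?_
        rw [lintegral_indicator_const (measurableSet_zeroBlock f g), one_mul, mu_zeroBlock]

/-- Solovay's criterion for blocks. -/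
theorem not_mlRandom_of_infinite (hf : Primrec f) {G : Set ℕ} (hG : SigmaOne A (· ∈ G))
    (hw : ∑' g : G, (2⁻¹ : ℝ≥0∞) ^ f g ≠ ∞) {X : ℕ → Bool}
    (hX : {g | g ∈ G ∧ X ∈ zeroBlock f g}.Infinite) : ¬ MLRandom A X := by
  obtain ⟨c, hc⟩ := ENNReal.exists_nat_gt hw
  have hc0 : (c : ℝ≥0∞) ≠ 0 := (lt_of_le_of_lt zero_le hc).ne'
  intro hr
  refine hr (fun n => Cyl (manyBlocks f G (2 ^ n * c))) ⟨_, ceSeqIn_iff.2 ?_, fun _ => rfl,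
    fun n X hX => ?_, fun n => ?_⟩ (Set.mem_iInter.2 fun n => mem_cyl_manyBlocks.2 ?_)
  · show SigmaOne A fun x : ℕ × List Bool => ∃ L : List ℕ, L.length = 2 ^ x.1 * c ∧
      (∀ j, j < L.length → ∀ i, i < j → ¬ L[i]? = L[j]?) ∧
      ∀ g, g ∈ L → g ∈ G ∧ ∀ i, i < f g → x.2[Nat.pair g i]? = some false
    refine SigmaOne.exists (SigmaOne.and (by fun_prop) (SigmaOne.and
      (PrimrecPred.sigmaOne (by fun_prop)) (SigmaOne.forall_mem (SigmaOne.and ?_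
      (PrimrecPred.sigmaOne (by fun_prop))) (by fun_prop))))
    exact hG.comp (f := fun x : ((ℕ × List Bool) × List ℕ) × ℕ => x.2) (by fun_prop)
  · obtain ⟨s, h1, h2⟩ := mem_cyl_manyBlocks.1 hX
    obtain ⟨t, hts, ht⟩ := Finset.exists_subset_card_eq
      (show 2 ^ n * c ≤ s.card by rw [h1]; gcongr <;> simp)
    exact mem_cyl_manyBlocks.2 ⟨t, ht, fun g hg => h2 g (hts hg)⟩
  · have h := (mul_mu_manyBlocks_le f G (2 ^ n * c)).trans hc.le
    push_cast at h
    rw [mul_comm _ (c : ℝ≥0∞), mul_assoc] at h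
    have h' := (ENNReal.mul_le_mul_iff_right hc0 (by simp)).1 (h.trans_eq (mul_one _).symm)
    rw [← ENNReal.inv_pow, ENNReal.le_inv_iff_mul_le, mul_comm]
    exact h'
  · obtain ⟨t, ht, hc⟩ := hX.exists_subset_card_eq (2 ^ n * c)
    exact ⟨t, hc, fun g hg => ht hg⟩

theorem mu_cyl_finset_of_length {T : Finset (List Bool)} {s : ℕ} (hT : ∀ ρ ∈ T, ρ.length = s) :
    mu (Cyl {ρ | ρ ∈ T}) = T.card * 2⁻¹ ^ s := by
  have hpf : PrefixFree {ρ | ρ ∈ T} :=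
    fun σ hσ τ hτ h => h.eq_of_length ((hT σ hσ).trans (hT τ hτ).symm)
  rw [hpf.mu_cyl]
  unfold weight
  rw [tsum_congr (g := fun _ => (2⁻¹ : ℝ≥0∞) ^ s) fun ρ => by rw [hT ρ.1 ρ.2]]
  refine (Finset.tsum_subtype T fun _ => (2⁻¹ : ℝ≥0∞) ^ s).trans ?_
  simp

/-- Some `Σ₁` property of the index holds whenever the closed set is null, and implies that its
measure is small. -/
theorem exists_sigmaOne_mu_le {W : α → Set (List Bool)} {e : α → ℕ}
    (hW : SigmaOne B fun x : α × List Bool => x.2 ∈ W x.1) (he : Primrec e) :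
    ∃ p : α → Prop, SigmaOne B p ∧ (∀ a, p a → mu (Cyl (W a))ᶜ ≤ 2⁻¹ ^ e a) ∧
      ∀ a, mu (Cyl (W a))ᶜ = 0 → p a := by
  classical
  refine ⟨fun a => ∃ T : List (List Bool), ∃ s : ℕ, T.length * 2 ^ e a ≤ 2 ^ s ∧
    (∀ ρ, ρ ∈ T → ρ.length = s) ∧ Cyl {ρ | ρ ∈ T ∨ ρ ∈ W a} = Set.univ, ?_, ?_, ?_⟩
  · refine SigmaOne.exists (SigmaOne.exists (SigmaOne.and (by fun_prop) (SigmaOne.and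
      (PrimrecPred.sigmaOne (by fun_prop)) (SigmaOne.cyl_eq_univ
      (W := fun x : (α × List (List Bool)) × ℕ => {ρ | ρ ∈ x.1.2 ∨ ρ ∈ W x.1.1})
      (SigmaOne.or ?_ ?_)))))
    · have : SigmaOne B fun x : ((α × List (List Bool)) × ℕ) × List Bool =>
        ∃ ρ, ρ ∈ x.1.1.2 ∧ ρ = x.2 := PrimrecPred.sigmaOne (by fun_prop)
      exact this.of_iff fun x => by simp
    · exact hW.comp (f := fun x : ((α × List (List Bool)) × ℕ) × List Bool => (x.1.1.1, x.2))
        (by fun_prop)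
  · rintro a ⟨T, s, h1, h2, h3⟩
    have hsub : (Cyl (W a))ᶜ ⊆ Cyl {ρ | ρ ∈ T.toFinset} := by
      intro X hX
      obtain ⟨n, hn | hn⟩ := mem_cyl.1 (h3 ▸ Set.mem_univ X : X ∈ Cyl {ρ | ρ ∈ T ∨ ρ ∈ W a})
      · exact mem_cyl.2 ⟨n, by simpa using hn⟩
      · exact absurd (mem_cyl.2 ⟨n, hn⟩) hX
    refine (measure_mono hsub).trans ?_
    rw [mu_cyl_finset_of_length fun ρ hρ => h2 ρ (by simpa using hρ), ← ENNReal.inv_pow,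
      ← ENNReal.inv_pow, ← div_eq_mul_inv, ENNReal.div_le_iff (by simp) (by simp), mul_comm,
      ← div_eq_mul_inv, ENNReal.le_div_iff_mul_le (by simp) (by simp)]
    have : T.toFinset.card * 2 ^ e a ≤ 2 ^ s :=
      le_trans (by gcongr; exact T.toFinset_card_le) h1
    exact_mod_cast this
  · intro a ha
    let T : ℕ → Finset (List Bool) := fun s =>
      (strings s).toFinset.filter fun ρ => ¬ Cyl {ρ} ⊆ Cyl (W a)
    have hT : ∀ s X, X ∈ Cyl {ρ | ρ ∈ T s} ↔ ¬ Cyl {initSeg X s} ⊆ Cyl (W a) := by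
      intro s X
      simp only [mem_cyl, T, Finset.mem_filter, List.mem_toFinset, mem_strings, Set.mem_ofPred_eq,
        length_initSeg]
      exact ⟨fun ⟨n, h1, h2⟩ => h1 ▸ h2, fun h => ⟨s, rfl, h⟩⟩
    have hanti : Antitone fun s => Cyl {ρ | ρ ∈ T s} := by
      intro s t hst X hX
      rw [hT] at hX ⊢
      refine fun h => hX (subset_trans (fun Y hY => ?_) h)
      rw [mem_cyl_singleton, length_initSeg] at hY ⊢
      rw [← take_initSeg X hst, hY, take_initSeg Y hst]
    have hinter : ⋂ s, Cyl {ρ | ρ ∈ T s} ⊆ (Cyl (W a))ᶜ := by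
      intro X hX hXW
      obtain ⟨n, hn⟩ := mem_cyl.1 hXW
      exact (hT n X).1 (Set.mem_iInter.1 hX n) (cyl_mono (by simpa using hn))
    have hlim := tendsto_measure_iInter_atTop (μ := mu)
      (fun s => (measurableSet_cyl {ρ | ρ ∈ T s}).nullMeasurableSet) hanti ⟨0, measure_ne_top _ _⟩
    rw [measure_mono_null hinter ha] at hlim
    obtain ⟨s, hs⟩ := (hlim.eventually_le_const
      (show (0 : ℝ≥0∞) < 2⁻¹ ^ e a from ENNReal.pow_pos (by simp) _)).exists
    have hlen : ∀ ρ ∈ T s, ρ.length = s := fun ρ hρ => by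
      simp only [T, Finset.mem_filter, List.mem_toFinset, mem_strings] at hρ
      exact hρ.1
    refine ⟨(T s).toList, s, ?_, fun ρ hρ => hlen ρ (by simpa using hρ),
      Set.eq_univ_of_forall fun X => ?_⟩
    · rw [Function.comp_apply, mu_cyl_finset_of_length hlen, ← ENNReal.inv_pow,
        ← ENNReal.inv_pow, ← div_eq_mul_inv, ENNReal.div_le_iff (by simp) (by simp), mul_comm,
        ← div_eq_mul_inv, ENNReal.le_div_iff_mul_le (by simp) (by simp)] at hs
      rw [Finset.length_toList]
      exact_mod_cast hs
    · by_cases hX : Cyl {initSeg X s} ⊆ Cyl (W a)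
      · obtain ⟨n, hn⟩ := mem_cyl.1 (@hX X (mem_cyl_singleton.2 (by simp)))
        exact mem_cyl.2 ⟨n, .inr hn⟩
      · obtain ⟨n, hn⟩ := mem_cyl.1 ((hT s X).2 hX)
        exact mem_cyl.2 ⟨n, .inl (by simpa using hn)⟩

end Blocks

section Domination

open scoped ENNReal

variable {A B : Set ℕ} {f : ℕ → ℕ}

/-- The sets of strings enumerated by a code. -/
def codeStrings (B : Set ℕ) (c : OracleCode) (n : ℕ) : Set (List Bool) :=
  {σ | (c.eval (chi B) (Nat.pair n (Encodable.encode σ))).Dom}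

theorem sigmaOne_codeStrings (B : Set ℕ) (c : OracleCode) (n : ℕ) :
    SigmaOne B (· ∈ codeStrings B c n) :=
  (sigmaOne_eval_dom c).comp (f := fun σ : List Bool => Nat.pair n (Encodable.encode σ))
    (by fun_prop)

theorem cyl_union (V W : Set (List Bool)) : Cyl (V ∪ W) = Cyl V ∪ Cyl W := by
  ext X
  simp only [mem_cyl, Set.mem_union, exists_or]

theorem mu_compl_cyl_union_ne_zero {V W : Set (List Bool)} (h : mu (Cyl V) < mu (Cyl W)ᶜ) :
    mu (Cyl (W ∪ V))ᶜ ≠ 0 := by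
  rw [cyl_union, Set.compl_union, ← Set.sdiff_eq]
  exact pos_iff_ne_zero.1 ((tsub_pos_of_lt h).trans_le le_measure_sdiff)

/-- A closed set of positive measure, co-c.e. in `B`, can be shrunk so as to avoid a
given test and lie in a block with index in `G`. -/
theorem exists_shrink {G : Set ℕ}
    (H : ∀ W : Set (List Bool), SigmaOne B (· ∈ W) → mu (Cyl W)ᶜ ≠ 0 →
      ∀ N, ∃ g ∈ G, N < g ∧ mu ((Cyl W)ᶜ ∩ zeroBlock f g) ≠ 0) (N : ℕ) (c : OracleCode)
    {W : Set (List Bool)} (hW : SigmaOne B (· ∈ W)) (hpos : mu (Cyl W)ᶜ ≠ 0) :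
    ∃ W' : Set (List Bool), SigmaOne B (· ∈ W') ∧ mu (Cyl W')ᶜ ≠ 0 ∧ W ⊆ W' ∧
      (∃ g ∈ G, N < g ∧ (Cyl W')ᶜ ⊆ zeroBlock f g) ∧
      ((∀ n, mu (Cyl (codeStrings B c n)) ≤ 2⁻¹ ^ n) → ∃ n, codeStrings B c n ⊆ W') := by
  obtain ⟨V, hV, hVpos, hWV, hVc⟩ : ∃ V : Set (List Bool), SigmaOne B (· ∈ V) ∧
      mu (Cyl V)ᶜ ≠ 0 ∧ W ⊆ V ∧
      ((∀ n, mu (Cyl (codeStrings B c n)) ≤ 2⁻¹ ^ n) → ∃ n, codeStrings B c n ⊆ V) := by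
    by_cases hc : ∀ n, mu (Cyl (codeStrings B c n)) ≤ 2⁻¹ ^ n
    · obtain ⟨n, hn⟩ := ((ENNReal.tendsto_pow_atTop_nhds_zero_of_lt_one
        (show (2⁻¹ : ℝ≥0∞) < 1 by simp)).eventually_lt_const (pos_iff_ne_zero.2 hpos)).exists
      exact ⟨W ∪ codeStrings B c n, SigmaOne.or hW (sigmaOne_codeStrings B c n),
        mu_compl_cyl_union_ne_zero ((hc n).trans_lt hn), Set.subset_union_left,
        fun _ => ⟨n, Set.subset_union_right⟩⟩
    · exact ⟨W, hW, hpos, subset_rfl, fun h => absurd h hc⟩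
  obtain ⟨g, hg, hNg, hmu⟩ := H V hV hVpos N
  have hcyl : (Cyl (V ∪ {σ | ∃ i, i < f g ∧ σ[Nat.pair g i]? = some true}))ᶜ =
      (Cyl V)ᶜ ∩ zeroBlock f g := by
    rw [cyl_union, Set.compl_union, zeroBlock_eq_compl_cyl]
  refine ⟨_, SigmaOne.or hV (PrimrecPred.sigmaOne ?_), hcyl ▸ hmu,
    hWV.trans Set.subset_union_left, ⟨g, hg, hNg, hcyl ▸ Set.inter_subset_right⟩,
    fun h => (hVc h).imp fun n hn => hn.trans Set.subset_union_left⟩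
  show PrimrecPred fun σ : List Bool => ∃ i, i < f g ∧ σ[Nat.pair g i]? = some true
  fun_prop

/-- If every closed set of positive measure, co-c.e. in `B`, meets late blocks of `G` in positive
measure, then some `B`-random sequence lies in infinitely many blocks of `G`. -/
theorem exists_mlRandom_infinite {G : Set ℕ}
    (H : ∀ W : Set (List Bool), SigmaOne B (· ∈ W) → mu (Cyl W)ᶜ ≠ 0 →
      ∀ N, ∃ g ∈ G, N < g ∧ mu ((Cyl W)ᶜ ∩ zeroBlock f g) ≠ 0) :
    ∃ X, MLRandom B X ∧ {g | g ∈ G ∧ X ∈ zeroBlock f g}.Infinite := by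
  have : Nonempty OracleCode := ⟨.zero⟩
  obtain ⟨e, he⟩ := exists_surjective_nat OracleCode
  let St := {W : Set (List Bool) // SigmaOne B (· ∈ W) ∧ mu (Cyl W)ᶜ ≠ 0}
  have hstep : ∀ (N : ℕ) (W : St), ∃ W' : St, W.1 ⊆ W'.1 ∧
      (∃ g ∈ G, N < g ∧ (Cyl W'.1)ᶜ ⊆ zeroBlock f g) ∧
      ((∀ n, mu (Cyl (codeStrings B (e N) n)) ≤ 2⁻¹ ^ n) →
        ∃ n, codeStrings B (e N) n ⊆ W'.1) := by
    intro N W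
    obtain ⟨W', h1, h2, h3⟩ := exists_shrink H N (e N) W.2.1 W.2.2
    exact ⟨⟨W', h1, h2⟩, h3⟩
  choose next hsub hblock htest using hstep
  have h0 : SigmaOne B (· ∈ (∅ : Set (List Bool))) ∧ mu (Cyl (∅ : Set (List Bool)))ᶜ ≠ 0 := by
    refine ⟨PrimrecPred.sigmaOne (p := fun _ => False) (by fun_prop), ?_⟩
    have : Cyl (∅ : Set (List Bool)) = ∅ := by simp [Cyl]
    simp [this]
  let F : ℕ → St := fun n => Nat.rec ⟨∅, h0⟩ next n
  obtain ⟨X, hX⟩ := IsCompact.nonempty_iInter_of_sequence_nonempty_isCompact_isClosed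
    (fun n => (Cyl (F n).1)ᶜ) (fun n => Set.compl_subset_compl.2 (cyl_mono (hsub n (F n))))
    (fun n => nonempty_of_measure_ne_zero (F n).2.2)
    (isOpen_cyl _).isClosed_compl.isCompact fun n => (isOpen_cyl _).isClosed_compl
  rw [Set.mem_iInter] at hX
  refine ⟨X, ?_, Set.infinite_of_forall_exists_gt fun N => ?_⟩
  · rintro U ⟨W, ⟨c, hc⟩, hU, -, hmu⟩ hXU
    obtain ⟨N, rfl⟩ := he c
    have hW : ∀ n, codeStrings B (e N) n = W n := fun n => Set.ext fun σ => (hc n σ).symm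
    obtain ⟨n, hn⟩ := htest N (F N) fun n => by
      rw [hW, ← hU]
      exact hmu n
    refine hX (N + 1) (cyl_mono hn ?_)
    rw [hW, ← hU]
    exact Set.mem_iInter.1 hXU n
  · obtain ⟨g, hg, hNg, h⟩ := hblock N (F N)
    exact ⟨g, ⟨hg, h (hX (N + 1))⟩, hNg⟩

/-- A family of blocks with infinite total weight covers almost every sequence infinitely often. -/
theorem mu_limsup_zeroBlock_eq_one {G : Set ℕ} (hw : ∑' g : G, (2⁻¹ : ℝ≥0∞) ^ f g = ∞) :
    mu (limsup (fun g => {X | g ∈ G ∧ X ∈ zeroBlock f g}) atTop) = 1 := by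
  have hpos : ∀ g ∈ G, {X | g ∈ G ∧ X ∈ zeroBlock f g} = zeroBlock f g := fun g hg => by simp [hg]
  have hneg : ∀ g, g ∉ G → {X | g ∈ G ∧ X ∈ zeroBlock f g} = ∅ := fun g hg => by simp [hg]
  have hms : ∀ g, MeasurableSet {X | g ∈ G ∧ X ∈ zeroBlock f g} := fun g =>
    (MeasurableSet.const _).inter (measurableSet_zeroBlock f g)
  refine ProbabilityTheory.measure_limsup_eq_one hms
    ((ProbabilityTheory.iIndepSet_iff_meas_biInter hms).2 fun s => ?_) ?_
  · by_cases hs : ∀ g ∈ s, g ∈ G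
    · rw [Finset.prod_congr rfl fun g hg => by rw [hpos g (hs g hg), mu_zeroBlock],
        ← mu_biInter_zeroBlock]
      exact congrArg mu (Set.iInter₂_congr fun g hg => hpos g (hs g hg))
    · push Not at hs
      obtain ⟨g, hg, hgG⟩ := hs
      rw [Finset.prod_eq_zero hg (by rw [hneg g hgG, measure_empty])]
      refine measure_mono_null (Set.biInter_subset_of_mem hg) ?_
      rw [hneg g hgG, measure_empty]
  · rw [← hw, tsum_subtype G fun g => (2⁻¹ : ℝ≥0∞) ^ f g]
    refine tsum_congr fun g => ?_
    by_cases hg : g ∈ G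
    · rw [hpos g hg, mu_zeroBlock, Set.indicator_of_mem hg]
    · rw [hneg g hg, measure_empty, Set.indicator_of_notMem hg]

/-- `LR`-reducibility lets one enumerate, in `B`, a superset of finite weight of a set of finite
weight that is c.e. in `A`. -/
theorem LRle.exists_superset (h : LRle A B) (hf : Primrec f) {G : Set ℕ}
    (hG : SigmaOne A (· ∈ G)) (hw : ∑' g : G, (2⁻¹ : ℝ≥0∞) ^ f g ≠ ∞) :
    ∃ G' : Set ℕ, SigmaOne B (· ∈ G') ∧ G ⊆ G' ∧ ∑' g : G', (2⁻¹ : ℝ≥0∞) ^ f g ≠ ∞ := by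
  obtain ⟨W, hW, hpos, N, hN⟩ : ∃ W : Set (List Bool), SigmaOne B (· ∈ W) ∧ mu (Cyl W)ᶜ ≠ 0 ∧
      ∃ N, ∀ g ∈ G, N < g → mu ((Cyl W)ᶜ ∩ zeroBlock f g) = 0 := by
    by_contra! hc
    obtain ⟨X, hX, hinf⟩ := exists_mlRandom_infinite hc
    exact not_mlRandom_of_infinite hf hG hw hinf (h X hX)
  have hcyl : ∀ g, (Cyl (W ∪ {σ | ∃ i, i < f g ∧ σ[Nat.pair g i]? = some true}))ᶜ =
      (Cyl W)ᶜ ∩ zeroBlock f g := fun g => by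
    rw [cyl_union, Set.compl_union, zeroBlock_eq_compl_cyl]
  obtain ⟨p, hp, hle, hnull⟩ := exists_sigmaOne_mu_le (B := B) (e := fun g : ℕ => g)
    (W := fun g => W ∪ {σ | ∃ i, i < f g ∧ σ[Nat.pair g i]? = some true})
    (SigmaOne.or (hW.comp (f := fun x : ℕ × List Bool => x.2) (by fun_prop))
      (PrimrecPred.sigmaOne (show PrimrecPred fun x : ℕ × List Bool =>
        ∃ i, i < f x.1 ∧ x.2[Nat.pair x.1 i]? = some true by fun_prop))) (by fun_prop)
  simp only [hcyl] at hle hnull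
  refine ⟨{g | g ≤ N ∨ p g}, SigmaOne.or (PrimrecPred.sigmaOne (by fun_prop)) hp,
    fun g hg => (le_or_gt g N).imp_right fun hNg => hnull g (hN g hg hNg), fun hw' => ?_⟩
  have hlim := mu_limsup_zeroBlock_eq_one hw'
  set S : ℕ → Set (ℕ → Bool) := fun g =>
    {X | g ∈ {g | g ≤ N ∨ p g} ∧ X ∈ zeroBlock f g} with hS
  have hb : ∀ g, mu ((Cyl W)ᶜ ∩ S g) ≤ 2 ^ N * 2⁻¹ ^ g := by
    intro g
    have h2 : (2 : ℝ≥0∞) ^ N * 2⁻¹ ^ N = 1 := by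
      rw [← mul_pow, ENNReal.mul_inv_cancel (by simp) (by simp), one_pow]
    by_cases hgN : g ≤ N
    · calc mu ((Cyl W)ᶜ ∩ S g) ≤ 1 := prob_le_one
        _ = 2 ^ N * 2⁻¹ ^ N := h2.symm
        _ ≤ 2 ^ N * 2⁻¹ ^ g := by
          gcongr _ * ?_
          exact pow_le_pow_right_of_le_one' (by simp [ENNReal.inv_le_one]) hgN
    · by_cases hg : p g
      · refine (measure_mono (Set.inter_subset_inter_right _ fun X hX => hX.2)).trans
          ((hle g hg).trans (le_mul_of_one_le_left' (one_le_pow₀ (by norm_num))))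
      · rw [hS]
        simp [hgN, hg]
  have hzero : mu (limsup (fun g => (Cyl W)ᶜ ∩ S g) atTop) = 0 := by
    refine measure_limsup_atTop_eq_zero (ne_top_of_le_ne_top ?_ (ENNReal.tsum_le_tsum hb))
    rw [ENNReal.tsum_mul_left, ENNReal.tsum_geometric, ENNReal.one_sub_inv_two, inv_inv]
    exact ENNReal.mul_ne_top (by simp) (by simp)
  have hms : MeasurableSet (limsup S atTop) := MeasurableSet.measurableSet_limsup fun g =>
    (MeasurableSet.const _).inter (measurableSet_zeroBlock f g)
  refine hpos (measure_mono_null (t := limsup (fun g => (Cyl W)ᶜ ∩ S g) atTop ∪ (limsup S atTop)ᶜ)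
    (fun X hX => ?_) (measure_union_null hzero ((prob_compl_eq_zero_iff hms).2 hlim)))
  by_cases hXS : X ∈ limsup S atTop
  · left
    rw [mem_limsup_iff_frequently_mem] at hXS ⊢
    exact hXS.mono fun g hg => ⟨hX, hg⟩
  · exact .inr hXS

end Domination

section Sigma2

open scoped ENNReal

variable {A B : Set ℕ}

/-- The `m`-th approximation to the statement that `τ` is an initial segment of the characteristic
function, given the matrices of `Π₂` definitions of a set and of its complement. -/
def ApproxSeg (q₁ q₀ : ℕ → ℕ → Prop) (m : ℕ) (τ : List ℕ) : Prop :=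
  ∀ i, i < τ.length → ∀ k, k < m → (τ[i]? = some 1 ∧ q₀ i k) ∨ (τ[i]? = some 0 ∧ q₁ i k)

theorem ApproxSeg.mono {q₁ q₀ : ℕ → ℕ → Prop} {m n : ℕ} {τ : List ℕ} (h : ApproxSeg q₁ q₀ n τ)
    (hmn : m ≤ n) : ApproxSeg q₁ q₀ m τ := fun i hi k hk => h i hi k (hk.trans_le hmn)

theorem forall_approxSeg_iff {q₁ q₀ : ℕ → ℕ → Prop} (h₁ : ∀ n, n ∈ A ↔ ∃ k, ¬ q₁ n k)
    (h₀ : ∀ n, n ∉ A ↔ ∃ k, ¬ q₀ n k) {τ : List ℕ} :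
    (∀ m, ApproxSeg q₁ q₀ m τ) ↔ τ = initSeg (chi A) τ.length := by
  rw [eq_initSeg_iff]
  have h₀' : ∀ n, n ∈ A ↔ ∀ k, q₀ n k := fun n => by simpa using (h₀ n).not
  have h₁' : ∀ n, n ∉ A ↔ ∀ k, q₁ n k := fun n => by simpa using (h₁ n).not
  constructor
  · intro h i hi
    have h' : ∀ k, (τ[i]? = some 1 ∧ q₀ i k) ∨ (τ[i]? = some 0 ∧ q₁ i k) :=
      fun k => h (k + 1) i hi k (Nat.lt_succ_self k)
    by_cases hA : i ∈ A
    · obtain ⟨k, hk⟩ := (h₁ i).1 hA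
      rw [chi_eq_one_iff.2 hA]
      exact ((h' k).resolve_right fun hc => hk hc.2).1
    · obtain ⟨k, hk⟩ := (h₀ i).1 hA
      rw [chi_eq_zero_iff.2 hA]
      exact ((h' k).resolve_left fun hc => hk hc.2).1
  · intro h m i hi k _
    rw [h i hi]
    by_cases hA : i ∈ A
    · exact .inl ⟨by rw [chi_eq_one_iff.2 hA], (h₀' i).1 hA k⟩
    · exact .inr ⟨by rw [chi_eq_zero_iff.2 hA], (h₁' i).1 hA k⟩

theorem SigmaOne.approxSeg {α : Type*} [Primcodable α] {q₁ q₀ : ℕ → ℕ → Prop}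
    (h₁ : SigmaOne B fun x : ℕ × ℕ => q₁ x.1 x.2) (h₀ : SigmaOne B fun x : ℕ × ℕ => q₀ x.1 x.2)
    {m : α → ℕ} {τ : α → List ℕ} (hm : Primrec m) (hτ : Primrec τ) :
    SigmaOne B fun a => ApproxSeg q₁ q₀ (m a) (τ a) := by
  unfold ApproxSeg
  refine SigmaOne.forall_lt (SigmaOne.forall_lt (SigmaOne.or (SigmaOne.and
    (PrimrecPred.sigmaOne (by fun_prop)) ?_) (SigmaOne.and
    (PrimrecPred.sigmaOne (by fun_prop)) ?_)) (by fun_prop)) (by fun_prop)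
  · exact h₀.comp (f := fun x : (α × ℕ) × ℕ => (x.1.2, x.2)) (by fun_prop)
  · exact h₁.comp (f := fun x : (α × ℕ) × ℕ => (x.1.2, x.2)) (by fun_prop)

/-- The exponent of the weight of a coded triple. -/
def tripleSize (g : ℕ) : ℕ :=
  ((Encodable.decode (α := ℕ × List Bool × List ℕ) g).map fun x => x.1 + x.2.1.length).getD 0

theorem primrec_tripleSize : Primrec tripleSize :=
  Primrec.option_getD.comp (Primrec.option_map (by fun_prop)
    (show Primrec fun x : ℕ × ℕ × List Bool × List ℕ => x.2.1 + x.2.2.1.length by fun_prop))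
    (Primrec.const 0)

theorem tripleSize_encode (x : ℕ × List Bool × List ℕ) :
    tripleSize (Encodable.encode x) = x.1 + x.2.1.length := by
  simp [tripleSize, -Encodable.encode_prod_val]

/-- The codes of the triples `(n, σ, τ)` such that `σ` is in the `n`-th set of strings with oracle
use `τ`. -/
def useTriples (A : Set ℕ) (M : ℕ → List Bool → List ℕ → Prop) : Set ℕ :=
  {g | ∃ x : ℕ × List Bool × List ℕ, Encodable.encode x = g ∧
    x.2.2 = initSeg (chi A) x.2.1.length ∧ M x.1 x.2.1 x.2.2}

theorem sigmaOne_useTriples {M : ℕ → List Bool → List ℕ → Prop}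
    (hM : PrimrecPred fun x : ℕ × List Bool × List ℕ => M x.1 x.2.1 x.2.2) :
    SigmaOne A (· ∈ useTriples A M) := by
  refine SigmaOne.exists (SigmaOne.and (PrimrecPred.sigmaOne (by fun_prop))
    (SigmaOne.and (by fun_prop) (PrimrecPred.sigmaOne ?_)))
  exact hM.comp (f := fun x : ℕ × ℕ × List Bool × List ℕ => x.2) (by fun_prop)

theorem tsum_useTriples_ne_top {M : ℕ → List Bool → List ℕ → Prop}
    (hM : ∀ n, PrefixFree {σ | M n σ (initSeg (chi A) σ.length)}) :
    ∑' g : useTriples A M, (2⁻¹ : ℝ≥0∞) ^ tripleSize g ≠ ∞ := by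
  let V : ℕ → Set (List Bool) := fun n => {σ | M n σ (initSeg (chi A) σ.length)}
  have hmem : ∀ x : Σ n, V n,
      Encodable.encode (x.1, x.2.1, initSeg (chi A) x.2.1.length) ∈ useTriples A M :=
    fun x => ⟨_, rfl, rfl, x.2.2⟩
  refine ne_top_of_le_ne_top (b := ∑' x : Σ n, V n, (2⁻¹ : ℝ≥0∞) ^ (x.1 + x.2.1.length)) ?_
    (tsum_le_of_surjective (f := fun x => ⟨_, hmem x⟩) ?_ fun x => ?_)
  · rw [ENNReal.tsum_sigma fun n (σ : V n) => (2⁻¹ : ℝ≥0∞) ^ (n + σ.1.length)]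
    refine ne_top_of_le_ne_top (b := ∑' n : ℕ, (2⁻¹ : ℝ≥0∞) ^ n) ?_
      (ENNReal.tsum_le_tsum fun n => ?_)
    · rw [ENNReal.tsum_geometric, ENNReal.one_sub_inv_two, inv_inv]
      simp
    · simp_rw [pow_add]
      rw [ENNReal.tsum_mul_left]
      refine mul_le_of_le_one_right' ?_
      exact (hM n).mu_cyl.symm.trans_le prob_le_one
  · rintro ⟨_, ⟨n, σ, τ⟩, rfl, hτ, hσ⟩
    dsimp only at hτ hσ
    subst hτ
    exact ⟨⟨n, σ, hσ⟩, rfl⟩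
  · rw [tripleSize_encode]

/-- The approximation to the `n`-th set of strings which uses only triples from `G`. -/
def approxStrings (q₁ q₀ : ℕ → ℕ → Prop) (M : ℕ → List Bool → List ℕ → Prop) (G : Set ℕ)
    (n m : ℕ) : Set (List Bool) :=
  {σ | ∃ τ : List ℕ, Encodable.encode (n, σ, τ) ∈ G ∧ τ.length = σ.length ∧ M n σ τ ∧
    ApproxSeg q₁ q₀ m τ}

theorem SigmaOne.approxStrings {q₁ q₀ : ℕ → ℕ → Prop} {M : ℕ → List Bool → List ℕ → Prop}
    {G : Set ℕ} (h₁ : SigmaOne B fun x : ℕ × ℕ => q₁ x.1 x.2)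
    (h₀ : SigmaOne B fun x : ℕ × ℕ => q₀ x.1 x.2)
    (hM : PrimrecPred fun x : ℕ × List Bool × List ℕ => M x.1 x.2.1 x.2.2)
    (hG : SigmaOne B (· ∈ G)) :
    SigmaOne B fun x : ℕ × List Bool =>
      x.2 ∈ LMD.approxStrings q₁ q₀ M G x.1.unpair.1 x.1.unpair.2 := by
  refine SigmaOne.exists (SigmaOne.and ?_ (SigmaOne.and (PrimrecPred.sigmaOne (by fun_prop))
    (SigmaOne.and (PrimrecPred.sigmaOne ?_) (SigmaOne.approxSeg h₁ h₀ (by fun_prop)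
    (by fun_prop)))))
  · exact hG.comp (f := fun x : (ℕ × List Bool) × List ℕ =>
      Encodable.encode (x.1.1.unpair.1, x.1.2, x.2)) (by fun_prop)
  · exact hM.comp (f := fun x : (ℕ × List Bool) × List ℕ => (x.1.1.unpair.1, x.1.2, x.2))
      (by fun_prop)

/-- Almost every sequence outside the `n`-th open set is outside some approximation. -/
theorem ae_exists_notMem_approxStrings {q₁ q₀ : ℕ → ℕ → Prop}
    (h₁ : ∀ n, n ∈ A ↔ ∃ k, ¬ q₁ n k) (h₀ : ∀ n, n ∉ A ↔ ∃ k, ¬ q₀ n k)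
    (M : ℕ → List Bool → List ℕ → Prop) {G : Set ℕ}
    (hG : ∑' g : G, (2⁻¹ : ℝ≥0∞) ^ tripleSize g ≠ ∞) (n : ℕ) :
    ∀ᵐ X ∂mu, X ∉ Cyl {σ | M n σ (initSeg (chi A) σ.length)} →
      ∃ m, X ∉ Cyl (approxStrings q₁ q₀ M G n m) := by
  let s : ℕ → Set (ℕ → Bool) := fun g =>
    {X | g ∈ G ∧ ∃ (σ : List Bool) (τ : List ℕ),
      Encodable.encode (n, σ, τ) = g ∧ X ∈ Cyl {σ}}
  have hs : mu (limsup s atTop) = 0 := by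
    refine measure_limsup_atTop_eq_zero (ne_top_of_le_ne_top
      (b := 2 ^ n * ∑' g : G, (2⁻¹ : ℝ≥0∞) ^ tripleSize g) (ENNReal.mul_ne_top (by simp) hG) ?_)
    rw [tsum_subtype G fun g => (2⁻¹ : ℝ≥0∞) ^ tripleSize g, ← ENNReal.tsum_mul_left]
    refine ENNReal.tsum_le_tsum fun g => ?_
    by_cases hg : g ∈ G ∧ ∃ (σ : List Bool) (τ : List ℕ),
        Encodable.encode (n, σ, τ) = g
    · obtain ⟨hg, σ, τ, rfl⟩ := hg
      rw [Set.indicator_of_mem hg, tripleSize_encode, pow_add, ← mul_assoc, ← mul_pow,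
        ENNReal.mul_inv_cancel (by simp) (by simp), one_pow, one_mul, ← mu_cyl_singleton]
      refine measure_mono ?_
      rintro X ⟨-, σ', τ', h, hX⟩
      obtain ⟨-, rfl, -⟩ := by simpa only [Prod.mk.injEq] using Encodable.encode_injective h
      exact hX
    · have : s g = ∅ := by
        refine Set.eq_empty_of_forall_notMem ?_
        rintro X ⟨h, σ, τ, h', -⟩
        exact hg ⟨h, σ, τ, h'⟩
      rw [this, measure_empty]
      exact zero_le
  refine (measure_eq_zero_iff_ae_notMem.1 hs).mono fun X hX hXV => ?_
  rw [mem_limsup_iff_frequently_mem, Nat.frequently_atTop_iff_infinite, Set.not_infinite] at hX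
  let R : ℕ → ℕ → Prop := fun m g => ∃ (σ : List Bool) (τ : List ℕ),
    Encodable.encode (n, σ, τ) = g ∧ X ∈ Cyl {σ} ∧ τ.length = σ.length ∧ M n σ τ ∧ ApproxSeg q₁ q₀ m τ
  have hR : ∀ g, ∀ᶠ m in atTop, ¬ R m g := by
    intro g
    by_contra hc
    rw [not_eventually] at hc
    have hall : ∀ m, R m g := fun m => by
      obtain ⟨m', hR', hm'⟩ := (hc.and_eventually (eventually_ge_atTop m)).exists
      obtain ⟨σ, τ, h1, h2, h3, h4, h5⟩ := not_not.1 hR'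
      exact ⟨σ, τ, h1, h2, h3, h4, h5.mono hm'⟩
    obtain ⟨σ, τ, rfl, h2, h3, h4, -⟩ := hall 0
    have h5 : τ = initSeg (chi A) τ.length := (forall_approxSeg_iff h₁ h₀).1 fun m => by
      obtain ⟨σ', τ', h, -, -, -, h5⟩ := hall m
      obtain ⟨-, -, rfl⟩ := by simpa only [Prod.mk.injEq] using Encodable.encode_injective h
      exact h5
    rw [h3] at h5
    rw [h5] at h4
    refine hXV (mem_cyl.2 ⟨σ.length, ?_⟩)
    rw [← mem_cyl_singleton.1 h2]
    exact h4
  obtain ⟨m, hm⟩ := ((eventually_all_finite hX).2 fun g _ => hR g).exists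
  refine ⟨m, fun hXm => ?_⟩
  rw [cyl_eq_biUnion] at hXm
  simp only [Set.mem_iUnion, exists_prop] at hXm
  obtain ⟨σ, ⟨τ, h1, h2⟩, h3⟩ := hXm
  exact hm _ ⟨h1, σ, τ, rfl, h3⟩ ⟨σ, τ, rfl, h3, h2⟩

theorem exists_sigma2_subclass (hT : TuringLE A (jump B)) (hLR : LRle A B) {P : Set (ℕ → Bool)}
    (hP : Sigma2In A P) : ∃ Q : Set (ℕ → Bool), Sigma2In B Q ∧ Q ⊆ P ∧ mu Q = mu P := by
  obtain ⟨W, hW, rfl⟩ := hP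
  obtain ⟨M, hM, hMW⟩ := (ceSeqIn_iff.1 hW).exists_prefixFree
  obtain ⟨q₁, q₀, hq₁, hq₀, h₁, h₀⟩ := hT.exists_not
  obtain ⟨G, hG, hsub, hw⟩ := hLR.exists_superset primrec_tripleSize (sigmaOne_useTriples hM)
    (tsum_useTriples_ne_top fun n => (hMW n).1)
  have hQP : ⋃ k : ℕ, (Cyl (approxStrings q₁ q₀ M G k.unpair.1 k.unpair.2))ᶜ ⊆
      ⋃ n, (Cyl (W n))ᶜ := by
    refine Set.iUnion_subset fun k => subset_trans ?_ (Set.subset_iUnion _ k.unpair.1)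
    rw [Set.compl_subset_compl, ← (hMW _).2]
    refine cyl_mono fun σ hσ => ⟨initSeg (chi A) σ.length, hsub ⟨_, rfl, rfl, hσ⟩, by simp, hσ, ?_⟩
    exact (forall_approxSeg_iff h₁ h₀).2 (by simp) _
  refine ⟨_, ⟨_, ceSeqIn_iff.2 (SigmaOne.approxStrings hq₁ hq₀ hM hG), rfl⟩, hQP,
    le_antisymm (measure_mono hQP) (measure_mono_ae ?_)⟩
  filter_upwards [ae_all_iff.2 fun n => ae_exists_notMem_approxStrings h₁ h₀ M hw n] with X hX hXP
  obtain ⟨n, hn⟩ := Set.mem_iUnion.1 hXP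
  obtain ⟨m, hm⟩ := hX n (by rw [(hMW n).2]; exact hn)
  exact Set.mem_iUnion.2 ⟨Nat.pair n m, by simpa using hm⟩

theorem Pi1In.sigma2In {P : Set (ℕ → Bool)} (h : Pi1In A P) : Sigma2In A P := by
  obtain ⟨W, hW, rfl⟩ := h
  refine ⟨fun _ => W, ceSeqIn_iff.2 ?_, (Set.iUnion_const _).symm⟩
  exact (ceIn_iff.1 hW).comp (f := fun x : ℕ × List Bool => x.2) (by fun_prop)

end Sigma2

/-- The equivalence of: (i) `A ≤_T B′` and `A ≤_LR B`; (ii) every `Π^A_1` class has a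
`Σ^B_2` subclass of the same measure; (iii) every `Σ^A_2` class has a `Σ^B_2` subclass of
the same measure. -/
theorem tfae_measure_subclass (A B : Set ℕ) :
    List.TFAE
      [ TuringLE A (jump B) ∧ LRle A B,
        ∀ P : Set (ℕ → Bool), Pi1In A P →
          ∃ Q : Set (ℕ → Bool), Sigma2In B Q ∧ Q ⊆ P ∧ mu Q = mu P,
        ∀ P : Set (ℕ → Bool), Sigma2In A P →
          ∃ Q : Set (ℕ → Bool), Sigma2In B Q ∧ Q ⊆ P ∧ mu Q = mu P ] := by
  tfae_have 1 → 3 := fun h P hP => exists_sigma2_subclass h.1 h.2 hP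
  tfae_have 3 → 2 := fun h P hP => h P hP.sigma2In
  tfae_have 2 → 1 := fun h =>
    ⟨HasSigma2Subclasses.turingLE h, HasSigma2Subclasses.lRle h⟩
  tfae_finish

end LMD
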